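/- arXiv:2409.07103 — 2 statements merged into one kernel-verified Lean document; each statement's English description precedes it below -/
import Mathlib

section
/- Let X be a separable complex Banach space and let T be a bounded linear operator on X. Assume that there is a finite or countably infinite family (E_i)_{i∈I} of 𝕋-eigenvector fields for T which is λ-spanning, where λ is the normalized Lebesgue measure on the unit circle 𝕋. Assume moreover that either (a) X has Rademacher type 2, or (b) X has Rademacher type p for some p ∈ [1,2) and each E_i is α_i-Hölder continuous for some exponent α_i > 1/p − 1/2. Then T is hereditarily frequently hypercyclic. -/
open Filter Topology Set
open scoped Classical

/-- The lower density of a set `A ⊆ ℕ`: `liminf_{N→∞} #(A ∩ [1,N]) / N`. -/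
noncomputable def lowerDensity (A : Set ℕ) : ℝ :=
  Filter.atTop.liminf fun N : ℕ => (((Finset.Icc 1 N).filter (· ∈ A)).card : ℝ) / N

/-- The visit set `N_T(x,V) = {n ∈ ℕ : Tⁿ x ∈ V}`. -/
def visitSet {X : Type*} [TopologicalSpace X] [AddCommGroup X] [Module ℂ X]
    (T : X →L[ℂ] X) (x : X) (V : Set X) : Set ℕ :=
  {n : ℕ | (T ^ n) x ∈ V}

/-- `T` is hereditarily frequently hypercyclic. -/
def HereditarilyFrequentlyHypercyclic {X : Type*} [TopologicalSpace X] [AddCommGroup X]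
    [Module ℂ X] (T : X →L[ℂ] X) : Prop :=
  ∀ (I : Type) [Countable I] (V : I → Set X) (A : I → Set ℕ),
    (∀ i, IsOpen (V i)) → (∀ i, (V i).Nonempty) → (∀ i, 0 < lowerDensity (A i)) →
    ∃ x : X, ∀ i, 0 < lowerDensity (visitSet T x (V i) ∩ A i)

/-- `X` has Rademacher type `p`: the average over all choices of signs of
`‖Σ ±x_k‖` is dominated by `C (Σ ‖x_k‖^p)^{1/p}`. -/
def HasRademacherType (X : Type*) [NormedAddCommGroup X] (p : ℝ) : Prop :=
  ∃ C : ℝ, ∀ (n : ℕ) (x : Fin n → X),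
    (∑ ε : Fin n → Bool, ‖∑ k, (if ε k then x k else -x k)‖) / 2 ^ n ≤
      C * (∑ k, ‖x k‖ ^ p) ^ (1 / p)

lemma pos_lowerDensity_iff (A : Set ℕ) : 0 < lowerDensity A ↔
    ∃ c : ℝ, 0 < c ∧ ∀ᶠ N : ℕ in atTop, c * N ≤ (((Finset.Icc 1 N).filter (· ∈ A)).card : ℝ) := by
  have h0 : ∀ N : ℕ, 0 ≤ (((Finset.Icc 1 N).filter (· ∈ A)).card : ℝ) / N := fun N => by positivity
  have h1 : ∀ N : ℕ, (((Finset.Icc 1 N).filter (· ∈ A)).card : ℝ) / N ≤ 1 := fun N => by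
    apply div_le_one_of_le₀ _ (by positivity)
    have := Finset.card_filter_le (Finset.Icc 1 N) (· ∈ A)
    simp only [Nat.card_Icc, Nat.add_sub_cancel] at this
    exact_mod_cast this
  have hb : IsBoundedUnder (· ≥ ·) atTop
      (fun N : ℕ => (((Finset.Icc 1 N).filter (· ∈ A)).card : ℝ) / N) :=
    isBoundedUnder_of ⟨0, h0⟩
  have hc : IsCoboundedUnder (· ≥ ·) atTop
      (fun N : ℕ => (((Finset.Icc 1 N).filter (· ∈ A)).card : ℝ) / N) :=
    (isBoundedUnder_of ⟨1, h1⟩ : IsBoundedUnder (· ≤ ·) atTop _).isCoboundedUnder_ge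
  constructor
  · intro h
    refine ⟨lowerDensity A / 2, by positivity, ?_⟩
    have := eventually_lt_of_lt_liminf (b := lowerDensity A / 2) (show _ < lowerDensity A by linarith) hb
    filter_upwards [this, eventually_gt_atTop 0] with N hN hN0
    have : (0:ℝ) < N := by exact_mod_cast hN0
    rw [lt_div_iff₀ this] at hN
    exact hN.le
  · rintro ⟨c, hc0, h⟩
    refine lt_of_lt_of_le hc0 ?_
    refine le_liminf_of_le hc ?_
    filter_upwards [h, eventually_gt_atTop 0] with N hN hN0
    have : (0:ℝ) < N := by exact_mod_cast hN0
    rw [le_div_iff₀ this]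
    exact hN

lemma pos_lowerDensity_mono {A B : Set ℕ} (h : A ⊆ B) (hA : 0 < lowerDensity A) :
    0 < lowerDensity B := by
  rw [pos_lowerDensity_iff] at *
  obtain ⟨c, hc, hA⟩ := hA
  refine ⟨c, hc, hA.mono fun N hN => hN.trans ?_⟩
  exact_mod_cast Finset.card_le_card (Finset.monotone_filter_right _ fun n _ hn => h hn)

/-- Subtracting a set that has few elements up to `N`, for all `N`. -/
lemma pos_lowerDensity_of_diff {A B C : Set ℕ} {c ρ : ℝ} (hρ : 2 * ρ < c)
    (_hρ0 : 0 ≤ ρ)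
    (hA : ∀ᶠ N : ℕ in atTop, c * N ≤ (((Finset.Icc 1 N).filter (· ∈ A)).card : ℝ))
    (hB : ∀ N : ℕ, (((Finset.range N).filter (· ∈ B)).card : ℝ) ≤ ρ * N)
    (hC : ∀ n ∈ A, n ∉ B → n ∈ C) : 0 < lowerDensity C := by
  rw [pos_lowerDensity_iff]
  refine ⟨c - 2 * ρ, by linarith, ?_⟩
  filter_upwards [hA, eventually_ge_atTop 1] with N hN h1
  have h2 := hB (N + 1)
  have h3 : ((Finset.Icc 1 N).filter (· ∈ A)).card ≤ ((Finset.Icc 1 N).filter (· ∈ C)).card +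
      ((Finset.range (N+1)).filter (· ∈ B)).card := by
    refine (Finset.card_le_card ?_).trans (Finset.card_union_le _ _)
    intro n hn
    simp only [Finset.mem_union, Finset.mem_filter, Finset.mem_Icc, Finset.mem_range] at *
    by_cases h : n ∈ B
    · right; exact ⟨by omega, h⟩
    · left; exact ⟨hn.1, hC n hn.2 h⟩
  have h3' : (((Finset.Icc 1 N).filter (· ∈ A)).card : ℝ) ≤ ((Finset.Icc 1 N).filter (· ∈ C)).card +
      ((Finset.range (N+1)).filter (· ∈ B)).card := by exact_mod_cast h3
  push_cast at h2
  have : (1:ℝ) ≤ N := by exact_mod_cast h1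
  nlinarith

/-- Maximal-type lemma: greedy covering. -/
lemma exists_good_shift {B : Set ℕ} {η ρ : ℝ} (_hη : 0 < ρ) (hρ : ρ < η)
    (hB : ∀ᶠ N : ℕ in atTop, (((Finset.range N).filter (· ∈ B)).card : ℝ) ≤ ρ * N) :
    ∃ M : ℕ, ∀ N : ℕ, (((Finset.range N).filter (fun n => M + n ∈ B)).card : ℝ) ≤ η * N := by
  by_contra! hcon
  choose g hg using hcon
  have hadd : ∀ M N : ℕ, (((Finset.range (M+N)).filter (· ∈ B)).card : ℝ) =
      ((Finset.range M).filter (· ∈ B)).card + ((Finset.range N).filter (fun n => M + n ∈ B)).card := by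
    intro M N
    simp only [Finset.card_filter]
    rw [Finset.sum_range_add]
    push_cast; rfl
  have hgpos : ∀ M, 1 ≤ g M := by
    intro M
    by_contra h
    have h0 : g M = 0 := by omega
    have := hg M
    rw [h0] at this
    simp at this
  let u : ℕ → ℕ := fun k => Nat.rec (motive := fun _ => ℕ) 0 (fun _ M => M + g M) k
  have hu : ∀ k, u (k+1) = u k + g (u k) := fun k => rfl
  have hk : ∀ k, k ≤ u k ∧ η * (u k : ℝ) ≤ ((Finset.range (u k)).filter (· ∈ B)).card := by
    intro k
    induction k with
    | zero => simp [u]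
    | succ k ih =>
      rw [hu, hadd]
      have := hgpos (u k)
      refine ⟨by omega, ?_⟩
      push_cast
      have := hg (u k)
      nlinarith [ih.2]
  obtain ⟨N₀, h⟩ := eventually_atTop.1 hB
  have h1 := h (u (N₀ + 1)) (by have := (hk (N₀+1)).1; omega)
  have h2 := (hk (N₀+1))
  have : (1:ℝ) ≤ u (N₀+1) := by exact_mod_cast (by omega : 1 ≤ u (N₀+1))
  nlinarith [h2.2]

open MeasureTheory in
lemma vol_circle_one : (volume : Measure (AddCircle (1:ℝ))).real univ = 1 := by
  simp [Measure.real, AddCircle.measure_univ]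

open MeasureTheory in
lemma integral_fourier_ne (j : ℤ) (hj : j ≠ 0) : ∫ t : AddCircle (1:ℝ), fourier j t = 0 :=
  integral_eq_zero_of_add_right_eq_neg (μ := volume) (fourier_add_half_inv_index hj one_pos)

lemma fourier_nsmul' (k : ℤ) (n : ℕ) (t : AddCircle (1:ℝ)) :
    fourier k (n • t) = fourier (k * n) t := by
  rw [fourier_apply, fourier_apply, mul_smul, natCast_zsmul]

open MeasureTheory in
/-- second moment of exponential sums -/
lemma weyl_second_moment (A : Set ℕ) (k : ℤ) (hk : k ≠ 0) (N : ℕ) :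
    ∫⁻ t : AddCircle (1:ℝ), ENNReal.ofReal
      (‖∑ n ∈ (Finset.Icc 1 N).filter (· ∈ A), fourier k (n • t)‖ ^ 2) ≤ N := by
  set s := (Finset.Icc 1 N).filter (· ∈ A) with hs
  have hcont : Continuous fun t : AddCircle (1:ℝ) => ‖∑ n ∈ s, fourier k (n • t)‖ ^ 2 := by fun_prop
  have hi : Integrable fun t : AddCircle (1:ℝ) => ‖∑ n ∈ s, fourier k (n • t)‖ ^ 2 :=
    hcont.integrable_of_hasCompactSupport (HasCompactSupport.of_compactSpace _)
  rw [← ofReal_integral_eq_lintegral_ofReal hi (Eventually.of_forall fun t => by positivity)]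
  have key : ((∫ t : AddCircle (1:ℝ), ‖∑ n ∈ s, fourier k (n • t)‖ ^ 2 : ℝ) : ℂ) = s.card := by
    rw [← integral_complex_ofReal]
    have e : ∀ t : AddCircle (1:ℝ), ((‖∑ n ∈ s, fourier k (n • t)‖ ^ 2 : ℝ) : ℂ) =
        ∑ n ∈ s, ∑ m ∈ s, fourier (k * (n - m)) t := by
      intro t
      rw [Complex.ofReal_pow, ← Complex.mul_conj', map_sum, Finset.sum_mul_sum]
      refine Finset.sum_congr rfl fun n _ => Finset.sum_congr rfl fun m _ => ?_
      rw [fourier_nsmul', fourier_nsmul', ← fourier_neg, ← fourier_add]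
      congr 2; ring
    have hintg : ∀ j : ℤ, Integrable (fun t : AddCircle (1:ℝ) => fourier j t) := fun j =>
      (fourier j).continuous.integrable_of_hasCompactSupport (HasCompactSupport.of_compactSpace _)
    simp_rw [e]
    rw [integral_finsetSum _ (fun n _ => integrable_finsetSum _ fun m _ => hintg _)]
    have h1 : ∀ n ∈ s, ∫ t : AddCircle (1:ℝ), ∑ m ∈ s, fourier (k * ((n:ℤ) - m)) t = 1 := by
      intro n hn
      rw [integral_finsetSum _ (fun m _ => hintg _), Finset.sum_eq_single_of_mem n hn]
      · simp [vol_circle_one]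
      · intro m _ hmn
        apply integral_fourier_ne
        apply mul_ne_zero hk
        rw [sub_ne_zero]; exact_mod_cast hmn.symm
    rw [Finset.sum_congr rfl h1]; simp
  have key' : (∫ t : AddCircle (1:ℝ), ‖∑ n ∈ s, fourier k (n • t)‖ ^ 2 : ℝ) = s.card := by
    exact_mod_cast key
  rw [key', ENNReal.ofReal_natCast]
  have := Finset.card_filter_le (Finset.Icc 1 N) (· ∈ A)
  simp only [Nat.card_Icc, Nat.add_sub_cancel] at this
  exact_mod_cast this

lemma gap_fill (A : Set ℕ) (v : ℕ → ℂ) (hv : ∀ n, ‖v n‖ ≤ 1)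
    (h : Tendsto (fun q : ℕ => ‖∑ n ∈ (Finset.Icc 1 (q^2)).filter (· ∈ A), v n‖ / (q^2 : ℝ)) atTop (𝓝 0)) :
    Tendsto (fun N : ℕ => ‖∑ n ∈ (Finset.Icc 1 N).filter (· ∈ A), v n‖ / (N : ℝ)) atTop (𝓝 0) := by
  have hs : Tendsto Nat.sqrt atTop atTop := by
    refine tendsto_atTop.2 fun b => ?_
    filter_upwards [eventually_ge_atTop (b*b)] with N hN
    exact Nat.le_sqrt.2 hN
  have h1 := h.comp hs
  have h2 : Tendsto (fun N : ℕ => 2 / (Nat.sqrt N : ℝ)) atTop (𝓝 0) :=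
    (tendsto_const_div_atTop_nhds_zero_nat 2).comp hs
  have h3 := h1.add h2
  rw [add_zero] at h3
  refine squeeze_zero' (Eventually.of_forall fun N => by positivity) ?_ h3
  filter_upwards [eventually_ge_atTop 1] with N hN
  set q := Nat.sqrt N with hq
  have hq1 : 1 ≤ q := Nat.le_sqrt.2 (by omega)
  have hqN : q^2 ≤ N := by rw [pow_two]; exact Nat.sqrt_le N
  have hNq : N ≤ q^2 + 2*q := by have := Nat.sqrt_le_add N; rw [← hq] at this; rw [pow_two]; omega
  have hsplit : (Finset.Icc 1 N).filter (· ∈ A) = (Finset.Icc 1 (q^2)).filter (· ∈ A) ∪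
      (Finset.Ioc (q^2) N).filter (· ∈ A) := by
    ext n; simp only [Finset.mem_union, Finset.mem_filter, Finset.mem_Icc, Finset.mem_Ioc]
    constructor
    · rintro ⟨h, h'⟩; simp only [h', and_true]; omega
    · rintro (⟨h, h'⟩ | ⟨h, h'⟩) <;> simp only [h', and_true] <;> omega
  have hdisj : Disjoint ((Finset.Icc 1 (q^2)).filter (· ∈ A)) ((Finset.Ioc (q^2) N).filter (· ∈ A)) := by
    rw [Finset.disjoint_left]; intro n; simp only [Finset.mem_filter, Finset.mem_Icc, Finset.mem_Ioc]
    intro h h'; omega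
  have hb : ‖∑ n ∈ (Finset.Ioc (q^2) N).filter (· ∈ A), v n‖ ≤ 2 * q := by
    refine (norm_sum_le_of_le _ (fun n _ => hv n)).trans ?_
    simp only [Finset.sum_const, nsmul_eq_mul, mul_one]
    have := Finset.card_filter_le (Finset.Ioc (q^2) N) (· ∈ A)
    rw [Nat.card_Ioc] at this
    exact_mod_cast (by omega : _ ≤ 2 * q)
  have hqR : (0:ℝ) < q := by exact_mod_cast hq1
  have hqN' : ((q:ℝ)^2) ≤ N := by exact_mod_cast hqN
  simp only [Function.comp]
  rw [hsplit, Finset.sum_union hdisj]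
  calc _ ≤ (‖∑ n ∈ (Finset.Icc 1 (q^2)).filter (· ∈ A), v n‖ + 2 * q) / (N:ℝ) := by
        gcongr; exact (norm_add_le _ _).trans (by gcongr)
    _ ≤ (‖∑ n ∈ (Finset.Icc 1 (q^2)).filter (· ∈ A), v n‖ + 2 * q) / ((q:ℝ)^2) := by gcongr
    _ = _ := by rw [add_div]; congr 1; field_simp

open MeasureTheory in
lemma weyl_ae (A : Set ℕ) (k : ℤ) (hk : k ≠ 0) :
    ∀ᵐ t : AddCircle (1:ℝ), Tendsto (fun N : ℕ =>
      ‖∑ n ∈ (Finset.Icc 1 N).filter (· ∈ A), fourier k (n • t)‖ / (N : ℝ)) atTop (𝓝 0) := by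
  let F : ℕ → AddCircle (1:ℝ) → ℝ := fun N t =>
    ‖∑ n ∈ (Finset.Icc 1 N).filter (· ∈ A), fourier k (n • t)‖
  have hFc : ∀ N, Continuous (F N) := fun N => by fun_prop
  have hm : ∀ q : ℕ, Measurable fun t => ENNReal.ofReal ((F ((q+1)^2) t / ((q+1:ℝ)^2))^2) := fun q => by
    have := (hFc ((q+1)^2)).measurable
    fun_prop
  have hintg : ∀ q : ℕ, ∫⁻ t, ENNReal.ofReal ((F ((q+1)^2) t / ((q+1:ℝ)^2))^2) ≤
      ENNReal.ofReal (1 / (q+1:ℝ)^2) := by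
    intro q
    have e : ∀ t, ENNReal.ofReal ((F ((q+1)^2) t / ((q+1:ℝ)^2))^2) =
        ENNReal.ofReal (F ((q+1)^2) t ^ 2) * ENNReal.ofReal (1 / (q+1:ℝ)^4) := by
      intro t
      rw [← ENNReal.ofReal_mul (by positivity)]; congr 1; field_simp
    simp_rw [e]
    rw [lintegral_mul_const _ (by have := (hFc ((q+1)^2)).measurable; fun_prop)]
    refine (mul_le_mul_left (weyl_second_moment A k hk ((q+1)^2)) _).trans ?_
    rw [← ENNReal.ofReal_natCast, ← ENNReal.ofReal_mul (by positivity)]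
    apply ENNReal.ofReal_le_ofReal
    push_cast
    apply le_of_eq; field_simp
  have hsum : ∑' q : ℕ, ∫⁻ t, ENNReal.ofReal ((F ((q+1)^2) t / ((q+1:ℝ)^2))^2) ≠ ⊤ := by
    refine ne_top_of_le_ne_top ?_ (ENNReal.tsum_le_tsum hintg)
    have : Summable fun q : ℕ => 1 / ((q:ℝ)+1)^2 := by
      have := (summable_nat_add_iff 1).2 (Real.summable_one_div_nat_pow (p := 2) |>.2 (by norm_num))
      simpa using this
    exact this.tsum_ofReal_ne_top
  rw [← lintegral_tsum (fun q => (hm q).aemeasurable)] at hsum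
  have hae := ae_lt_top (Measurable.tsum hm) hsum
  filter_upwards [hae] with t ht
  apply gap_fill A (fun n => fourier k (n • t)) (fun n => by rw [fourier_apply]; exact (Circle.norm_coe _).le)
  rw [← tendsto_add_atTop_iff_nat 1]
  have h1 := ENNReal.tendsto_atTop_zero_of_tsum_ne_top ht.ne
  have h2 := (ENNReal.tendsto_toReal ENNReal.zero_ne_top).comp h1
  have h3 : Tendsto (fun q : ℕ => (F ((q+1)^2) t / ((q+1:ℝ)^2))^2) atTop (𝓝 0) := by
    refine h2.congr fun q => ?_
    simp only [Function.comp]; rw [ENNReal.toReal_ofReal (by positivity)]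
  have h4 := h3.sqrt
  rw [Real.sqrt_zero] at h4
  refine h4.congr fun q => ?_
  rw [Real.sqrt_sq (by simp only [F]; positivity)]
  simp only [F]; push_cast; rfl

open MeasureTheory in
lemma equidist (A : Set ℕ) (t : AddCircle (1:ℝ))
    (ht : ∀ k : ℤ, k ≠ 0 → Tendsto (fun N : ℕ =>
      ‖∑ n ∈ (Finset.Icc 1 N).filter (· ∈ A), fourier k (n • t)‖ / (N : ℝ)) atTop (𝓝 0))
    (g : C(AddCircle (1:ℝ), ℂ)) :
    Tendsto (fun N : ℕ =>
      ‖∑ n ∈ (Finset.Icc 1 N).filter (· ∈ A), (g (n • t) - ∫ x, g x)‖ / (N : ℝ)) atTop (𝓝 0) := by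
  have hI : ∀ g : C(AddCircle (1:ℝ), ℂ), Integrable (fun x => g x) := fun g =>
    g.continuous.integrable_of_hasCompactSupport (HasCompactSupport.of_compactSpace _)
  let W : Submodule ℂ C(AddCircle (1:ℝ), ℂ) :=
    { carrier := {g | Tendsto (fun N : ℕ =>
        ‖∑ n ∈ (Finset.Icc 1 N).filter (· ∈ A), (g (n • t) - ∫ x, g x)‖ / (N : ℝ)) atTop (𝓝 0)}
      zero_mem' := by simp
      add_mem' := by
        intro a b ha hb
        have h := Tendsto.add ha hb
        rw [add_zero] at h
        refine squeeze_zero (fun N => by positivity) (fun N => ?_) h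
        rw [← add_div]
        gcongr
        refine le_trans (le_of_eq ?_) (norm_add_le _ _)
        rw [← Finset.sum_add_distrib]
        congr 1
        refine Finset.sum_congr rfl fun n _ => ?_
        simp only [ContinuousMap.add_apply]
        rw [integral_add (hI a) (hI b)]
        ring
      smul_mem' := by
        intro c a ha
        have h := Tendsto.const_mul ‖c‖ ha
        rw [mul_zero] at h
        refine h.congr fun N => ?_
        rw [← mul_div_assoc, ← norm_mul, Finset.mul_sum]
        congr 2
        refine Finset.sum_congr rfl fun n _ => ?_
        simp only [ContinuousMap.smul_apply, smul_eq_mul]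
        rw [integral_const_mul]
        ring }
  have hclosed : IsClosed (W : Set C(AddCircle (1:ℝ), ℂ)) := by
    rw [← isSeqClosed_iff_isClosed]
    intro u g hu hg
    change Tendsto _ _ _
    rw [Metric.tendsto_atTop]
    intro ε hε
    obtain ⟨j, hj⟩ := (Metric.tendsto_atTop.1 hg (ε/4) (by positivity))
    have hj := hj j le_rfl
    have huj : Tendsto (fun N : ℕ =>
        ‖∑ n ∈ (Finset.Icc 1 N).filter (· ∈ A), (u j (n • t) - ∫ x, u j x)‖ / (N : ℝ)) atTop (𝓝 0) := hu j
    obtain ⟨N₀, hN₀⟩ := Metric.tendsto_atTop.1 huj (ε/4) (by positivity)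
    refine ⟨N₀ + 1, fun N hN => ?_⟩
    have h1 := hN₀ N (by omega)
    rw [Real.dist_0_eq_abs, abs_of_nonneg (by positivity)] at h1 ⊢
    have hNpos : (0:ℝ) < N := by exact_mod_cast (by omega : 0 < N)
    rw [div_lt_iff₀ hNpos] at h1 ⊢
    have hp : ∀ x, ‖g x - u j x‖ ≤ ε/4 := fun x => by
      rw [← dist_eq_norm]
      refine (ContinuousMap.dist_apply_le_dist x).trans ?_
      rw [dist_comm]; exact hj.le
    have hintg : ‖(∫ x, g x) - ∫ x, u j x‖ ≤ ε/4 := by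
      rw [← integral_sub (hI g) (hI _)]
      refine (norm_integral_le_of_norm_le_const (C := ε/4) (Eventually.of_forall hp)).trans ?_
      rw [vol_circle_one, mul_one]
    have hd : ‖∑ n ∈ (Finset.Icc 1 N).filter (· ∈ A), (g (n • t) - ∫ x, g x)‖ ≤
        ‖∑ n ∈ (Finset.Icc 1 N).filter (· ∈ A), (u j (n • t) - ∫ x, u j x)‖ +
        ‖∑ n ∈ (Finset.Icc 1 N).filter (· ∈ A), ((g (n • t) - u j (n • t)) - ((∫ x, g x) - ∫ x, u j x))‖ := by
      refine le_trans (le_of_eq ?_) (norm_add_le _ _)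
      rw [← Finset.sum_add_distrib]
      congr 1
      refine Finset.sum_congr rfl fun n _ => ?_
      ring
    have hd2 : ‖∑ n ∈ (Finset.Icc 1 N).filter (· ∈ A), ((g (n • t) - u j (n • t)) - ((∫ x, g x) - ∫ x, u j x))‖
        ≤ (ε/2) * N := by
      refine (norm_sum_le_of_le (f := fun n => ((g (n • t) - u j (n • t)) - ((∫ x, g x) - ∫ x, u j x)))
        (n := fun _ => ε/2) _ (fun n _ => ?_)).trans ?_
      · refine (norm_sub_le _ _).trans ?_
        linarith [hp (n • t)]
      · simp only [Finset.sum_const, nsmul_eq_mul]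
        have := Finset.card_filter_le (Finset.Icc 1 N) (· ∈ A)
        simp only [Nat.card_Icc, Nat.add_sub_cancel] at this
        have : (((Finset.Icc 1 N).filter (· ∈ A)).card : ℝ) ≤ N := by exact_mod_cast this
        nlinarith
    nlinarith
  have hsub : Submodule.span ℂ (range (@fourier (1:ℝ))) ≤ W := by
    rw [Submodule.span_le]
    rintro _ ⟨k, rfl⟩
    change Tendsto _ _ _
    by_cases hk : k = 0
    · subst hk; simp [vol_circle_one]
    · rw [integral_fourier_ne k hk]
      simpa only [sub_zero] using ht k hk
  have htop : W = ⊤ := by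
    rw [eq_top_iff, ← span_fourier_closure_eq_top]
    exact Submodule.topologicalClosure_minimal _ hsub hclosed
  have : g ∈ W := by rw [htop]; trivial
  exact this

open MeasureTheory in
lemma weyl_pos (A : Set ℕ) (hA : 0 < lowerDensity A) :
    ∀ᵐ t : AddCircle (1:ℝ), ∀ z : Circle, ∀ ε : ℝ, 0 < ε →
      0 < lowerDensity {n ∈ A | dist (AddCircle.toCircle t ^ n) z < ε} := by
  have h1 : ∀ᵐ t : AddCircle (1:ℝ), ∀ k : ℤ, k ≠ 0 → Tendsto (fun N : ℕ =>
      ‖∑ n ∈ (Finset.Icc 1 N).filter (· ∈ A), fourier k (n • t)‖ / (N : ℝ)) atTop (𝓝 0) := by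
    rw [ae_all_iff]; intro k
    by_cases hk : k = 0
    · simp [hk]
    · filter_upwards [weyl_ae A k hk] with t ht _ using ht
  filter_upwards [h1] with t ht z ε hε
  let r : AddCircle (1:ℝ) → ℝ := fun x => max 0 (1 - dist (AddCircle.toCircle x) z / ε)
  have hrc : Continuous r := by
    have : Continuous (AddCircle.toCircle : AddCircle (1:ℝ) → Circle) := AddCircle.continuous_toCircle
    fun_prop
  have hr0 : ∀ x, 0 ≤ r x := fun x => le_max_left _ _
  have hr1 : ∀ x, r x ≤ 1 := fun x => max_le zero_le_one (by
    have : 0 ≤ dist (AddCircle.toCircle x) z / ε := by positivity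
    linarith)
  have hrsupp : ∀ x, ¬ dist (AddCircle.toCircle x) z < ε → r x = 0 := fun x hx => by
    apply max_eq_left
    have : 1 ≤ dist (AddCircle.toCircle x) z / ε := by rw [le_div_iff₀ hε]; linarith
    linarith
  obtain ⟨x₀, hx₀⟩ : ∃ x₀ : AddCircle (1:ℝ), AddCircle.toCircle x₀ = z :=
    ⟨(AddCircle.homeomorphCircle one_ne_zero).symm z, by
      rw [← AddCircle.homeomorphCircle_apply one_ne_zero]; simp⟩
  have hpos : 0 < ∫ x, r x := by
    apply hrc.integral_pos_of_hasCompactSupport_nonneg_nonzero (HasCompactSupport.of_compactSpace _)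
      hr0 (x := x₀)
    simp [r, hx₀]
  set m := ∫ x, r x with hm
  have heq := equidist A t ht ⟨fun x => (r x : ℂ), by fun_prop⟩
  simp only [ContinuousMap.coe_mk] at heq
  rw [integral_complex_ofReal, ← hm] at heq
  obtain ⟨B, hB⟩ : ∃ B : Set ℕ, B = {n ∈ A | dist (AddCircle.toCircle t ^ n) z < ε} := ⟨_, rfl⟩
  rw [← hB]
  rw [pos_lowerDensity_iff] at hA ⊢
  obtain ⟨c, hc, hA⟩ := hA
  refine ⟨m * c / 2, by positivity, ?_⟩
  have hev := (tendsto_order.1 heq).2 (m * c / 2) (by positivity)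
  filter_upwards [hev, hA, eventually_gt_atTop 0] with N h1 h2 h3
  have hNpos : (0:ℝ) < N := by exact_mod_cast h3
  rw [div_lt_iff₀ hNpos] at h1
  set s := (Finset.Icc 1 N).filter (· ∈ A) with hs
  have h4 : (∑ n ∈ s, ((r (n • t) : ℂ) - (m:ℂ))) = ((∑ n ∈ s, r (n • t) - s.card * m : ℝ) : ℂ) := by
    push_cast; rw [Finset.sum_sub_distrib]; simp
  rw [h4, Complex.norm_real, Real.norm_eq_abs] at h1
  have h5 := (abs_lt.1 h1).1
  have h6 : ∑ n ∈ s, r (n • t) ≤ ((Finset.Icc 1 N).filter (· ∈ B)).card := by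
    have : (Finset.Icc 1 N).filter (· ∈ B) =
        s.filter (fun n => dist (AddCircle.toCircle t ^ n) z < ε) := by
      ext n; simp [hs, hB, and_assoc]
    rw [this, Finset.card_filter]
    push_cast
    refine Finset.sum_le_sum fun n _ => ?_
    rw [← AddCircle.toCircle_nsmul]
    split_ifs with h
    · exact hr1 _
    · exact (hrsupp _ h).le
  refine le_trans ?_ h6
  nlinarith [mul_le_mul_of_nonneg_left h2 hpos.le]

def GenP (A : ℕ → Set ℕ) (F : Finset Circle) : Prop :=
  ∀ (l : ℕ) (z : Circle → Circle) (ε : ℝ), 0 < ε →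
    0 < lowerDensity {n | n ∈ A l ∧ ∀ w ∈ F, dist (w ^ n) (z w) < ε}

lemma lowerDensity_empty : ¬ 0 < lowerDensity ∅ := by
  simp [lowerDensity]

open MeasureTheory in
lemma GenP.ae_insert {A : ℕ → Set ℕ} {F : Finset Circle} (h : GenP A F) :
    ∀ᵐ t : AddCircle (1:ℝ), AddCircle.toCircle t ∉ F ∧ GenP A (insert (AddCircle.toCircle t) F) := by
  let d : ℕ → Circle → Circle := fun j w =>
    if hw : w ∈ F then TopologicalSpace.denseSeq (F → Circle) j ⟨w, hw⟩ else 1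
  have hd : ∀ (z : Circle → Circle) (ε : ℝ), 0 < ε → ∃ j, ∀ w ∈ F, dist (d j w) (z w) < ε := by
    intro z ε hε
    obtain ⟨j, hj⟩ := (TopologicalSpace.denseRange_denseSeq (F → Circle)).exists_dist_lt
      (fun w : F => z w) hε
    refine ⟨j, fun w hw => ?_⟩
    simp only [d, hw, dif_pos]
    rw [dist_comm]
    exact (dist_le_pi_dist (fun w : F => z w) _ ⟨w, hw⟩).trans_lt hj
  have h1 : ∀ᵐ t : AddCircle (1:ℝ), ∀ (l j q : ℕ), ∀ z : Circle, ∀ ε : ℝ, 0 < ε →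
      0 < lowerDensity {n ∈ {n | n ∈ A l ∧ ∀ w ∈ F, dist (w ^ n) (d j w) < 1 / ((q:ℝ)+1)} |
        dist (AddCircle.toCircle t ^ n) z < ε} := by
    rw [ae_all_iff]; intro l
    rw [ae_all_iff]; intro j
    rw [ae_all_iff]; intro q
    exact weyl_pos _ (h l _ _ (by positivity))
  filter_upwards [h1] with t ht
  set w₀ := AddCircle.toCircle t with hw₀
  have key : ∀ (l : ℕ) (z : Circle → Circle) (z₀ : Circle) (ε : ℝ), 0 < ε →
      0 < lowerDensity {n | n ∈ A l ∧ dist (w₀ ^ n) z₀ < ε ∧ ∀ w ∈ F, dist (w ^ n) (z w) < ε} := by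
    intro l z z₀ ε hε
    obtain ⟨j, hj⟩ := hd z (ε/2) (by positivity)
    obtain ⟨q, hq⟩ := exists_nat_one_div_lt (half_pos hε)
    refine pos_lowerDensity_mono ?_ (ht l j q z₀ ε hε)
    rintro n ⟨⟨h1, h2⟩, h3⟩
    refine ⟨h1, h3, fun w hw => ?_⟩
    refine (dist_triangle _ (d j w) _).trans_lt ?_
    linarith [h2 w hw, hj w hw]
  refine ⟨fun hmem => ?_, fun l z ε hε => ?_⟩
  · have h0 := key 0 (fun _ => 1) (-1) (1/2) (by norm_num)
    refine lowerDensity_empty (pos_lowerDensity_mono ?_ h0)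
    rintro n ⟨_, h2, h3⟩
    have h3 := h3 w₀ hmem
    have h4 : dist (-1 : Circle) 1 ≤ dist (w₀ ^ n) (-1) + dist (w₀ ^ n) 1 := dist_triangle_left _ _ _
    have h5 : dist (-1 : Circle) 1 = 2 := by
      change dist (((-1 : Circle)) : ℂ) ((1 : Circle) : ℂ) = 2
      rw [dist_eq_norm, Circle.coe_neg, Circle.coe_one]
      norm_num
    linarith
  · refine pos_lowerDensity_mono ?_ (key l z (z w₀) ε hε)
    rintro n ⟨h1, h2, h3⟩
    refine ⟨h1, fun w hw => ?_⟩
    rcases Finset.mem_insert.1 hw with rfl | hw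
    · exact h2
    · exact h3 w hw

section blocks
variable {X : Type*} [NormedAddCommGroup X] [NormedSpace ℂ X]

lemma pow_apply_eig (T : X →L[ℂ] X) {e : X} {w : ℂ} (h : T e = w • e) (n : ℕ) :
    (T ^ n) e = w ^ n • e := by
  induction n with
  | zero => simp
  | succ n ih => rw [pow_succ', mul_apply_eq_comp, ih, map_smul, h, smul_smul, pow_succ]

lemma pow_apply_sum (T : X →L[ℂ] X) {J : Finset Circle} {h : Circle → X}
    (hh : ∀ w ∈ J, T (h w) = (w : ℂ) • h w) (n : ℕ) :
    (T ^ n) (∑ w ∈ J, h w) = ∑ w ∈ J, (w : ℂ) ^ n • h w := by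
  rw [map_sum]
  exact Finset.sum_congr rfl fun w hw => pow_apply_eig T (hh w hw) n

def GoodVec (T : X →L[ℂ] X) (e : X) : Prop := ∀ ε : ℝ, 0 < ε →
  MeasureTheory.volume {t : AddCircle (1:ℝ) | ∃ e', ‖e' - e‖ < ε ∧
    T e' = (AddCircle.toCircle t : ℂ) • e'} ≠ 0

def BL (T : X →L[ℂ] X) (A : ℕ → Set ℕ) (v : X) : Prop :=
  ∀ F, GenP A F → ∀ ε : ℝ, 0 < ε → ∀ η : ℝ, 0 < η → ∃ J, Disjoint F J ∧ GenP A (F ∪ J) ∧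
    ∃ h : Circle → X, (∀ w ∈ J, T (h w) = (w : ℂ) • h w) ∧ ‖∑ w ∈ J, h w - v‖ < ε ∧
      ∀ᶠ N : ℕ in atTop,
        (((Finset.range N).filter (fun n => η < ‖(T ^ n) (∑ w ∈ J, h w)‖)).card : ℝ) ≤ η * N

lemma BL.add {T : X →L[ℂ] X} {A : ℕ → Set ℕ} {v v' : X} (h : BL T A v) (h' : BL T A v') :
    BL T A (v + v') := by
  intro F hF ε hε η hη
  obtain ⟨J, hJ, hP, f, hf, hfv, hfN⟩ := h F hF (ε/2) (by positivity) (η/2) (by positivity)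
  obtain ⟨J', hJ', hP', f', hf', hfv', hfN'⟩ := h' (F ∪ J) hP (ε/2) (by positivity) (η/2) (by positivity)
  have hJJ : Disjoint J J' := (Finset.disjoint_union_left.1 hJ').2
  have hs : ∑ w ∈ J ∪ J', (if w ∈ J then f w else f' w) = ∑ w ∈ J, f w + ∑ w ∈ J', f' w := by
    rw [Finset.sum_union hJJ]
    congr 1
    · exact Finset.sum_congr rfl fun w hw => by simp [hw]
    · exact Finset.sum_congr rfl fun w hw => by simp [Finset.disjoint_right.1 hJJ hw]
  refine ⟨J ∪ J', ?_, ?_, fun w => if w ∈ J then f w else f' w, ?_, ?_, ?_⟩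
  · rw [Finset.disjoint_union_right]
    exact ⟨hJ, (Finset.disjoint_union_left.1 hJ').1⟩
  · rw [← Finset.union_assoc]; exact hP'
  · intro w hw
    dsimp only
    split_ifs with h
    · exact hf w h
    · exact hf' w ((Finset.mem_union.1 hw).resolve_left h)
  · rw [hs, add_sub_add_comm]
    exact (norm_add_le _ _).trans_lt (by linarith)
  · rw [hs]
    filter_upwards [hfN, hfN'] with N h1 h2
    have h3 : ((Finset.range N).filter (fun n => η < ‖(T ^ n) (∑ w ∈ J, f w + ∑ w ∈ J', f' w)‖)).card ≤
        ((Finset.range N).filter (fun n => η/2 < ‖(T ^ n) (∑ w ∈ J, f w)‖)).card +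
        ((Finset.range N).filter (fun n => η/2 < ‖(T ^ n) (∑ w ∈ J', f' w)‖)).card := by
      refine (Finset.card_le_card ?_).trans (Finset.card_union_le _ _)
      intro n
      simp only [Finset.mem_union, Finset.mem_filter]
      rintro ⟨hn, h⟩
      simp only [hn, true_and]
      by_contra! hcon
      rw [map_add] at h
      linarith [norm_add_le ((T ^ n) (∑ w ∈ J, f w)) ((T ^ n) (∑ w ∈ J', f' w))]
    have h3' : (((Finset.range N).filter (fun n => η < ‖(T ^ n) (∑ w ∈ J, f w + ∑ w ∈ J', f' w)‖)).card : ℝ) ≤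
        ((Finset.range N).filter (fun n => η/2 < ‖(T ^ n) (∑ w ∈ J, f w)‖)).card +
        ((Finset.range N).filter (fun n => η/2 < ‖(T ^ n) (∑ w ∈ J', f' w)‖)).card := by
      exact_mod_cast h3
    linarith

lemma BL.closed {T : X →L[ℂ] X} {A : ℕ → Set ℕ} {v : X}
    (h : ∀ ε : ℝ, 0 < ε → ∃ v', ‖v' - v‖ < ε ∧ BL T A v') : BL T A v := by
  intro F hF ε hε η hη
  obtain ⟨v', hv', hB⟩ := h (ε/2) (by positivity)
  obtain ⟨J, hJ, hP, f, hf, hfv, hfN⟩ := hB F hF (ε/2) (by positivity) η hη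
  refine ⟨J, hJ, hP, f, hf, ?_, hfN⟩
  calc _ = ‖(∑ w ∈ J, f w - v') + (v' - v)‖ := by congr 1; abel
    _ < ε := (norm_add_le _ _).trans_lt (by linarith)

lemma GoodVec.smul {T : X →L[ℂ] X} {e : X} (h : GoodVec T e) (c : ℂ) : GoodVec T (c • e) := by
  intro ε hε h0
  have hc : 0 < ‖c‖ + 1 := by positivity
  refine h (ε / (‖c‖ + 1)) (by positivity) (MeasureTheory.measure_mono_null ?_ h0)
  rintro t ⟨e', h1, h2⟩
  refine ⟨c • e', ?_, ?_⟩
  · rw [← smul_sub, norm_smul]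
    rw [lt_div_iff₀ hc] at h1
    nlinarith [norm_nonneg (e' - e)]
  · rw [map_smul, h2, smul_comm]

lemma GoodVec.exists_many {T : X →L[ℂ] X} {A : ℕ → Set ℕ} {e : X} (he : GoodVec T e)
    {F : Finset Circle} (hF : GenP A F) {δ : ℝ} (hδ : 0 < δ) (N : ℕ) :
    ∃ J, Disjoint F J ∧ GenP A (F ∪ J) ∧ J.card = N ∧ ∃ h : Circle → X,
      (∀ w ∈ J, T (h w) = (w : ℂ) • h w) ∧ ∀ w ∈ J, ‖h w - e‖ < δ := by
  induction N with
  | zero => exact ⟨∅, by simp, by simpa using hF, rfl, 0, by simp, by simp⟩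
  | succ N ih =>
    obtain ⟨J, hJ, hP, hc, h, hT, hn⟩ := ih
    have hae := hP.ae_insert
    obtain ⟨t, ⟨e', he1, he2⟩, ht1, ht2⟩ : ∃ t, t ∈ {t : AddCircle (1:ℝ) | ∃ e', ‖e' - e‖ < δ ∧
        T e' = (AddCircle.toCircle t : ℂ) • e'} ∧ AddCircle.toCircle t ∉ F ∪ J ∧
          GenP A (insert (AddCircle.toCircle t) (F ∪ J)) := by
      by_contra! hcon
      refine he δ hδ (MeasureTheory.measure_mono_null ?_ (MeasureTheory.ae_iff.1 hae))
      intro t ht hh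
      exact hcon t ht hh.1 hh.2
    rw [Finset.mem_union, not_or] at ht1
    refine ⟨insert (AddCircle.toCircle t) J, ?_, ?_, ?_, Function.update h (AddCircle.toCircle t) e', ?_, ?_⟩
    · rw [Finset.disjoint_insert_right]; exact ⟨ht1.1, hJ⟩
    · rwa [Finset.union_insert]
    · rw [Finset.card_insert_of_notMem ht1.2, hc]
    · intro w hw
      by_cases hwt : w = AddCircle.toCircle t
      · subst hwt; simpa using he2
      · rw [Function.update_of_ne hwt]
        exact hT w ((Finset.mem_insert.1 hw).resolve_left hwt)
    · intro w hw
      by_cases hwt : w = AddCircle.toCircle t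
      · subst hwt; simpa using he1
      · rw [Function.update_of_ne hwt]
        exact hn w ((Finset.mem_insert.1 hw).resolve_left hwt)

lemma geom_bound (w w' : Circle) (h : w ≠ w') :
    ∃ C : ℝ, ∀ M : ℕ, ‖∑ n ∈ Finset.range M, (w:ℂ)^n * (starRingEnd ℂ) ((w':ℂ)^n)‖ ≤ C := by
  have hne : (w:ℂ) * (starRingEnd ℂ) (w':ℂ) ≠ 1 := by
    intro h1
    apply h
    rw [← Circle.coe_inv_eq_conj, ← Circle.coe_mul] at h1
    have : w * w'⁻¹ = 1 := by ext; exact h1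
    exact mul_inv_eq_one.1 this
  refine ⟨2 / ‖(w:ℂ) * (starRingEnd ℂ) (w':ℂ) - 1‖, fun M => ?_⟩
  simp_rw [map_pow, ← mul_pow]
  rw [geom_sum_eq hne, norm_div]
  gcongr
  refine (norm_sub_le _ _).trans ?_
  simp only [norm_pow, norm_mul, RCLike.norm_conj, Circle.norm_coe]
  norm_num

lemma mean_square (J : Finset Circle) : ∃ C : ℝ, ∀ M : ℕ,
    ∑ n ∈ Finset.range M, ‖∑ w ∈ J, (w:ℂ)^n‖^2 ≤ J.card * M + C := by
  have h1 : ∀ p : Circle × Circle, ∃ C : ℝ, p.1 ≠ p.2 →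
      ∀ M : ℕ, ‖∑ n ∈ Finset.range M, (p.1:ℂ)^n * (starRingEnd ℂ) ((p.2:ℂ)^n)‖ ≤ C := by
    intro p
    by_cases h : p.1 = p.2
    · exact ⟨0, fun h' => absurd h h'⟩
    · obtain ⟨C, hC⟩ := geom_bound _ _ h
      exact ⟨C, fun _ => hC⟩
  choose C hC using h1
  refine ⟨∑ w ∈ J, ∑ w' ∈ J, if w = w' then 0 else C (w, w'), fun M => ?_⟩
  have e : ((∑ n ∈ Finset.range M, ‖∑ w ∈ J, (w:ℂ)^n‖^2 : ℝ) : ℂ) =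
      ∑ w ∈ J, ∑ w' ∈ J, ∑ n ∈ Finset.range M, (w:ℂ)^n * (starRingEnd ℂ) ((w':ℂ)^n) := by
    push_cast
    simp_rw [← Complex.mul_conj', map_sum, Finset.sum_mul_sum]
    rw [Finset.sum_comm]
    refine Finset.sum_congr rfl fun w _ => ?_
    rw [Finset.sum_comm]
  have h2 : ∑ n ∈ Finset.range M, ‖∑ w ∈ J, (w:ℂ)^n‖^2 ≤
      ∑ w ∈ J, ∑ w' ∈ J, ((if w = w' then (M:ℝ) else 0) + (if w = w' then 0 else C (w, w'))) := by
    calc _ = ‖((∑ n ∈ Finset.range M, ‖∑ w ∈ J, (w:ℂ)^n‖^2 : ℝ) : ℂ)‖ := by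
          rw [Complex.norm_real, Real.norm_of_nonneg (by positivity)]
      _ ≤ _ := by
        rw [e]
        refine norm_sum_le_of_le _ fun w _ => norm_sum_le_of_le _ fun w' _ => ?_
        split_ifs with h
        · refine (norm_sum_le_of_le (n := fun _ => 1) _ fun n _ => ?_).trans ?_
          · simp [Circle.norm_coe]
          · simp
        · rw [zero_add]; exact hC (w, w') h M
  refine h2.trans (le_of_eq ?_)
  simp_rw [Finset.sum_add_distrib]
  congr 1
  simp

lemma GoodVec.bl {T : X →L[ℂ] X} {A : ℕ → Set ℕ} {e : X} (he : GoodVec T e) : BL T A e := by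
  intro F hF ε hε η hη
  set c : ℝ := η / (2 * (‖e‖ + 1)) with hc
  have hcpos : 0 < c := by positivity
  obtain ⟨N, hN⟩ := exists_nat_gt (2 / (c^2 * η))
  have hNpos : (0:ℝ) < N := lt_trans (by positivity) hN
  obtain ⟨J, hJ, hP, hcard, h, hT, hn⟩ := he.exists_many hF (δ := min ε (η/2)) (by positivity) N
  obtain ⟨C, hC⟩ := mean_square J
  refine ⟨J, hJ, hP, fun w => ((1 / N : ℝ) : ℂ) • h w, ?_, ?_, ?_⟩
  · intro w hw
    rw [map_smul, hT w hw, smul_comm]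
  · rw [← Finset.smul_sum]
    have e1 : ((1 / N : ℝ) : ℂ) • ∑ w ∈ J, h w - e = ((1 / N : ℝ) : ℂ) • ∑ w ∈ J, (h w - e) := by
      rw [Finset.sum_sub_distrib, smul_sub]
      congr 1
      rw [Finset.sum_const, hcard, ← Nat.cast_smul_eq_nsmul ℂ, smul_smul]
      push_cast
      rw [one_div_mul_cancel (by exact_mod_cast hNpos.ne'), one_smul]
    rw [e1, norm_smul, Complex.norm_real, Real.norm_of_nonneg (by positivity)]
    have : ‖∑ w ∈ J, (h w - e)‖ < N * ε := by
      refine (norm_sum_le _ _).trans_lt ?_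
      rw [← hcard, ← nsmul_eq_mul]
      rw [← Finset.sum_const]
      refine Finset.sum_lt_sum_of_nonempty ?_ (fun w hw => (hn w hw).trans_le (min_le_left _ _))
      rw [← Finset.card_pos, hcard]; exact_mod_cast hNpos
    rw [one_div, inv_mul_lt_iff₀ hNpos]; exact this
  · have hbad : ∀ n : ℕ, η < ‖(T ^ n) (∑ w ∈ J, ((1 / N : ℝ) : ℂ) • h w)‖ →
        c * N ≤ ‖∑ w ∈ J, (w:ℂ)^n‖ := by
      intro n hlt
      rw [← Finset.smul_sum, map_smul, pow_apply_sum T hT, norm_smul, Complex.norm_real,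
        Real.norm_of_nonneg (by positivity), one_div, lt_inv_mul_iff₀ hNpos] at hlt
      have e2 : ∑ w ∈ J, (w:ℂ)^n • h w = (∑ w ∈ J, (w:ℂ)^n) • e + ∑ w ∈ J, (w:ℂ)^n • (h w - e) := by
        rw [Finset.sum_smul, ← Finset.sum_add_distrib]
        exact Finset.sum_congr rfl fun w _ => by rw [smul_sub]; abel
      have h3 : ‖∑ w ∈ J, (w:ℂ)^n • (h w - e)‖ ≤ N * (η/2) := by
        rw [← hcard, ← nsmul_eq_mul, ← Finset.sum_const]
        refine norm_sum_le_of_le _ fun w hw => ?_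
        rw [norm_smul, norm_pow, Circle.norm_coe, one_pow, one_mul]
        exact (hn w hw).le.trans (min_le_right _ _)
      have h4 : ‖∑ w ∈ J, (w:ℂ)^n • h w‖ ≤ ‖∑ w ∈ J, (w:ℂ)^n‖ * ‖e‖ + N * (η/2) := by
        rw [e2]
        refine (norm_add_le _ _).trans ?_
        rw [norm_smul]; gcongr
      have h5 : c * (2 * (‖e‖ + 1)) = η := by rw [hc]; field_simp
      by_contra! hcon
      have h6 : ‖∑ w ∈ J, (w:ℂ)^n‖ * ‖e‖ ≤ (c * N) * (‖e‖ + 1) := by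
        gcongr; linarith
      nlinarith
    have hlarge : ∀ᶠ M : ℕ in atTop, C ≤ N * M := by
      filter_upwards [eventually_ge_atTop ⌈C⌉₊] with M hM
      have h1 : C ≤ M := (Nat.le_ceil C).trans (by exact_mod_cast hM)
      have h2 : (1:ℝ) ≤ N := by exact_mod_cast (by exact_mod_cast hNpos : 0 < N)
      nlinarith [(Nat.cast_nonneg M : (0:ℝ) ≤ M)]
    filter_upwards [hlarge] with M hM
    set S := (Finset.range M).filter (fun n => η < ‖(T ^ n) (∑ w ∈ J, ((1 / N : ℝ) : ℂ) • h w)‖) with hS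
    have h7 : (S.card : ℝ) * (c * N)^2 ≤ ∑ n ∈ Finset.range M, ‖∑ w ∈ J, (w:ℂ)^n‖^2 := by
      rw [← nsmul_eq_mul, ← Finset.sum_const]
      refine (Finset.sum_le_sum fun n hn => ?_).trans
        (Finset.sum_le_sum_of_subset_of_nonneg (Finset.filter_subset _ _) fun n _ _ => by positivity)
      have := hbad n (Finset.mem_filter.1 hn).2
      gcongr
    have h8 := h7.trans (hC M)
    rw [hcard] at h8
    rw [div_lt_iff₀ (by positivity)] at hN
    have h9 : (S.card : ℝ) * (c * N)^2 ≤ (η * M) * (c * N)^2 := by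
      have : (2:ℝ) * (N * M) ≤ (N * (c^2 * η)) * (N * M) := by gcongr
      nlinarith
    exact le_of_mul_le_mul_right h9 (by positivity)

lemma BL.all {T : X →L[ℂ] X} {A : ℕ → Set ℕ}
    (hd : Dense (Submodule.span ℂ {e | GoodVec T e} : Set X)) (v : X) : BL T A v := by
  apply BL.closed
  intro ε hε
  obtain ⟨v', hv', hd'⟩ := Metric.dense_iff.1 hd v ε hε
  refine ⟨v', by simpa [dist_eq_norm] using hv', ?_⟩
  clear hv'
  have hz : BL T A (0 : X) := by
    intro F hF ε hε η hη
    refine ⟨∅, by simp, by simpa using hF, 0, by simp, by simpa using hε, ?_⟩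
    refine Eventually.of_forall fun N => ?_
    simp [not_lt.2 hη.le]
    positivity
  rw [SetLike.mem_coe] at hd'
  induction hd' using Submodule.closure_induction with
  | zero => exact hz
  | add x y _ _ hx hy => exact hx.add hy
  | smul_mem c x hx => exact (GoodVec.smul hx c).bl

end blocks

section final
variable {X : Type*} [NormedAddCommGroup X] [NormedSpace ℂ X]

/-- `y` is `η`-small along its orbit, with few exceptions. -/
def QSmall (T : X →L[ℂ] X) (y : X) (η : ℝ) : Prop :=
  ∀ N : ℕ, (((Finset.range N).filter (fun n => η < ‖(T ^ n) y‖)).card : ℝ) ≤ η * N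

lemma QSmall.zero (T : X →L[ℂ] X) : QSmall T (0 : X) 0 := by
  intro N; simp

lemma QSmall.add {T : X →L[ℂ] X} {y y' : X} {η η' : ℝ} (h : QSmall T y η) (h' : QSmall T y' η') :
    QSmall T (y + y') (η + η') := by
  intro N
  have h3 : ((Finset.range N).filter (fun n => η + η' < ‖(T ^ n) (y + y')‖)).card ≤
      ((Finset.range N).filter (fun n => η < ‖(T ^ n) y‖)).card +
      ((Finset.range N).filter (fun n => η' < ‖(T ^ n) y'‖)).card := by
    refine (Finset.card_le_card ?_).trans (Finset.card_union_le _ _)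
    intro n
    simp only [Finset.mem_union, Finset.mem_filter]
    rintro ⟨hn, h⟩
    simp only [hn, true_and]
    by_contra! hcon
    rw [map_add] at h
    linarith [norm_add_le ((T ^ n) y) ((T ^ n) y')]
  have h3' : (((Finset.range N).filter (fun n => η + η' < ‖(T ^ n) (y + y')‖)).card : ℝ) ≤
      ((Finset.range N).filter (fun n => η < ‖(T ^ n) y‖)).card +
      ((Finset.range N).filter (fun n => η' < ‖(T ^ n) y'‖)).card := by exact_mod_cast h3
  linarith [h N, h' N]

lemma QSmall.mono {T : X →L[ℂ] X} {y : X} {η η' : ℝ} (h : QSmall T y η) (hη : η ≤ η') :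
    QSmall T y η' := by
  intro N
  have : ((Finset.range N).filter (fun n => η' < ‖(T ^ n) y‖)).card ≤
      ((Finset.range N).filter (fun n => η < ‖(T ^ n) y‖)).card :=
    Finset.card_le_card (Finset.monotone_filter_right _ fun n _ hn => hη.trans_lt hn)
  have h2 : (((Finset.range N).filter (fun n => η' < ‖(T ^ n) y‖)).card : ℝ) ≤
      ((Finset.range N).filter (fun n => η < ‖(T ^ n) y‖)).card := by exact_mod_cast this
  exact h2.trans ((h N).trans (by gcongr))

lemma QSmall.lim {T : X →L[ℂ] X} {u : ℕ → X} {y : X} {η : ℝ} (h : ∀ᶠ k in atTop, QSmall T (u k) η)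
    (hu : Tendsto u atTop (𝓝 y)) : QSmall T y η := by
  intro N
  have h1 : ∀ᶠ k in atTop, ∀ n ∈ (Finset.range N).filter (fun n => η < ‖(T ^ n) y‖),
      η < ‖(T ^ n) (u k)‖ := by
    rw [Filter.eventually_all_finset]
    intro n hn
    have : Tendsto (fun k => ‖(T ^ n) (u k)‖) atTop (𝓝 ‖(T ^ n) y‖) :=
      (((T ^ n).continuous.tendsto y).comp hu).norm
    exact (tendsto_order.1 this).1 _ (Finset.mem_filter.1 hn).2
  obtain ⟨k, hk, hk'⟩ := (h.and h1).exists
  refine le_trans ?_ (hk N)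
  have : ((Finset.range N).filter (fun n => η < ‖(T ^ n) y‖)).card ≤
      ((Finset.range N).filter (fun n => η < ‖(T ^ n) (u k)‖)).card :=
    Finset.card_le_card fun n hn =>
      Finset.mem_filter.2 ⟨(Finset.mem_filter.1 hn).1, hk' n hn⟩
  exact_mod_cast this

lemma QSmall.norm_le {T : X →L[ℂ] X} {y : X} {η : ℝ} (h : QSmall T y η) (hη : η < 1) :
    ‖y‖ ≤ η := by
  by_contra! hc
  have := h 1
  simp [Finset.filter_singleton, hc] at this
  linarith

/-- a finite stage of the construction -/
def Stage (T : X →L[ℂ] X) (A : ℕ → Set ℕ) (S : X) : Prop :=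
  ∃ F, GenP A F ∧ ∃ f : Circle → X, (∀ w ∈ F, T (f w) = (w : ℂ) • f w) ∧ S = ∑ w ∈ F, f w

lemma stage_step {T : X →L[ℂ] X} {A : ℕ → Set ℕ}
    (hd : Dense (Submodule.span ℂ {e | GoodVec T e} : Set X))
    {S : X} (hS : Stage T A S) (l : ℕ) (x : X) {r η : ℝ} (hr : 0 < r) (hη : 0 < η) :
    ∃ S', Stage T A S' ∧ QSmall T (S' - S) η ∧
      0 < lowerDensity {n | n ∈ A l ∧ ‖(T ^ n) S' - x‖ < r} := by
  obtain ⟨F, hF, f, hf, rfl⟩ := hS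
  obtain ⟨J, hJ, hP, h, hh, hv, hN⟩ := BL.all (A := A) hd (x - ∑ w ∈ F, f w) F hF (r/2) (by positivity)
    (η/2) (by positivity)
  have hN' : ∀ᶠ N : ℕ in atTop,
      (((Finset.range N).filter (· ∈ {n : ℕ | η < ‖(T ^ n) (∑ w ∈ J, h w)‖})).card : ℝ) ≤ (η/2) * N := by
    filter_upwards [hN] with N hN
    refine le_trans ?_ hN
    have : ((Finset.range N).filter (· ∈ {n : ℕ | η < ‖(T ^ n) (∑ w ∈ J, h w)‖})).card ≤
        ((Finset.range N).filter (fun n => η/2 < ‖(T ^ n) (∑ w ∈ J, h w)‖)).card :=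
      Finset.card_le_card (Finset.monotone_filter_right _ fun n _ hn => by
        have hn : η < ‖(T ^ n) (∑ w ∈ J, h w)‖ := hn
        change η/2 < _
        linarith)
    exact_mod_cast this
  obtain ⟨M, hM⟩ := exists_good_shift (η := η) (half_pos hη) (by linarith) hN'
  have hs : ∑ w ∈ F ∪ J, (if w ∈ F then f w else (w:ℂ)^M • h w) =
      ∑ w ∈ F, f w + (T ^ M) (∑ w ∈ J, h w) := by
    rw [Finset.sum_union hJ, pow_apply_sum T hh]
    congr 1
    · exact Finset.sum_congr rfl fun w hw => by simp [hw]
    · exact Finset.sum_congr rfl fun w hw => by simp [Finset.disjoint_right.1 hJ hw]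
  refine ⟨∑ w ∈ F, f w + (T ^ M) (∑ w ∈ J, h w), ⟨F ∪ J, hP, fun w => if w ∈ F then f w else (w:ℂ)^M • h w, ?_, hs.symm⟩, ?_, ?_⟩
  · intro w hw
    by_cases h1 : w ∈ F
    · simp only [if_pos h1]; exact hf w h1
    · simp only [if_neg h1]
      rw [map_smul, hh w ((Finset.mem_union.1 hw).resolve_left h1), smul_comm]
  · intro N
    rw [add_sub_cancel_left]
    refine le_trans (le_of_eq ?_) (hM N)
    norm_cast
    congr 1
    refine Finset.filter_congr fun n _ => ?_
    rw [mem_ofPred_eq, add_comm M n, pow_add, mul_apply_eq_comp]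
  · set K : ℝ := ∑ w ∈ F, ‖f w‖ + ∑ w ∈ J, ‖h w‖ with hK
    have hK0 : 0 ≤ K := by positivity
    refine pos_lowerDensity_mono ?_ (hP l (fun w => if w ∈ F then 1 else (w ^ M)⁻¹)
      (r / (2 * (K + 1))) (by positivity))
    rintro n ⟨hn, hw⟩
    refine ⟨hn, ?_⟩
    set ρ := r / (2 * (K + 1)) with hρ
    have hρ0 : 0 < ρ := by positivity
    have h1 : ‖(T ^ n) (∑ w ∈ F, f w) - ∑ w ∈ F, f w‖ ≤ ρ * ∑ w ∈ F, ‖f w‖ := by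
      rw [pow_apply_sum T hf, ← Finset.sum_sub_distrib, Finset.mul_sum]
      refine norm_sum_le_of_le _ fun w hwF => ?_
      have := hw w (Finset.mem_union_left _ hwF)
      simp only [hwF, if_true] at this
      change dist ((w ^ n : Circle) : ℂ) ((1 : Circle) : ℂ) < ρ at this
      rw [dist_eq_norm, Circle.coe_pow, Circle.coe_one] at this
      have e : (w:ℂ)^n • f w - f w = ((w:ℂ)^n - 1) • f w := by rw [sub_smul, one_smul]
      rw [e, norm_smul]
      gcongr
    have h2 : ‖(T ^ n) ((T ^ M) (∑ w ∈ J, h w)) - ∑ w ∈ J, h w‖ ≤ ρ * ∑ w ∈ J, ‖h w‖ := by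
      rw [← mul_apply_eq_comp, ← pow_add, pow_apply_sum T hh, ← Finset.sum_sub_distrib, Finset.mul_sum]
      refine norm_sum_le_of_le _ fun w hwJ => ?_
      have := hw w (Finset.mem_union_right _ hwJ)
      simp only [Finset.disjoint_right.1 hJ hwJ, if_false] at this
      change dist ((w ^ n : Circle) : ℂ) (((w ^ M)⁻¹ : Circle) : ℂ) < ρ at this
      rw [dist_eq_norm, Circle.coe_inv, Circle.coe_pow, Circle.coe_pow] at this
      have hwM : (w:ℂ)^M ≠ 0 := pow_ne_zero _ (Circle.coe_ne_zero w)
      have e : (w:ℂ)^(n+M) • h w - h w = ((w:ℂ)^M * ((w:ℂ)^n - ((w:ℂ)^M)⁻¹)) • h w := by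
        rw [mul_sub, mul_inv_cancel₀ hwM, sub_smul, one_smul, ← pow_add, add_comm]
      rw [e, norm_smul, norm_mul, norm_pow, Circle.norm_coe, one_pow, one_mul]
      gcongr
    have e : (T ^ n) (∑ w ∈ F, f w + (T ^ M) (∑ w ∈ J, h w)) - x =
        ((T ^ n) (∑ w ∈ F, f w) - ∑ w ∈ F, f w) +
        ((T ^ n) ((T ^ M) (∑ w ∈ J, h w)) - ∑ w ∈ J, h w) +
        (∑ w ∈ J, h w - (x - ∑ w ∈ F, f w)) := by
      rw [map_add]; abel
    rw [e]
    have h3 : ρ * (2 * (K + 1)) = r := by rw [hρ]; field_simp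
    have := norm_add₃_le (a := ((T ^ n) (∑ w ∈ F, f w) - ∑ w ∈ F, f w))
      (b := ((T ^ n) ((T ^ M) (∑ w ∈ J, h w)) - ∑ w ∈ J, h w))
      (c := (∑ w ∈ J, h w - (x - ∑ w ∈ F, f w)))
    nlinarith

/-- counting function eventually at least `c * N` -/
def DensGe (B : Set ℕ) (c : ℝ) : Prop :=
  ∀ᶠ N : ℕ in atTop, c * N ≤ (((Finset.Icc 1 N).filter (· ∈ B)).card : ℝ)

lemma DensGe.of_pos {B : Set ℕ} (h : 0 < lowerDensity B) : ∃ c : ℝ, 0 < c ∧ DensGe B c :=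
  (pos_lowerDensity_iff B).1 h

/-- the abstract construction -/
lemma hfh_of_dense_good [CompleteSpace X] {T : X →L[ℂ] X}
    (hd : Dense (Submodule.span ℂ {e | GoodVec T e} : Set X))
    (A : ℕ → Set ℕ) (hA : ∀ l, 0 < lowerDensity (A l)) (a : ℕ → X) (r : ℕ → ℝ) (hr : ∀ l, 0 < r l) :
    ∃ x : X, ∀ l, 0 < lowerDensity {n | n ∈ A l ∧ ‖(T ^ n) x - a l‖ < r l} := by
  -- state: the stage vector and the tolerance for the next step
  let St := {p : X × ℝ // Stage T A p.1 ∧ 0 < p.2 ∧ p.2 < 1}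
  have step : ∀ (l : ℕ) (p : St), ∃ p' : St, QSmall T (p'.1.1 - p.1.1) p.1.2 ∧
      p'.1.2 ≤ p.1.2 / 2 ∧ p'.1.2 ≤ r l / 4 ∧ ∃ c : ℝ, 8 * p'.1.2 ≤ c ∧
        DensGe {n | n ∈ A l ∧ ‖(T ^ n) p'.1.1 - a l‖ < r l / 2} c := by
    rintro l ⟨⟨S, η⟩, hS, hη, hη1⟩
    obtain ⟨S', h1, h2, h3⟩ := stage_step hd hS l (a l) (half_pos (hr l)) hη
    obtain ⟨c, hc, h3⟩ := DensGe.of_pos h3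
    have := hr l
    simp only at hη hη1
    refine ⟨⟨(S', min (η/2) (min (r l / 4) (c / 8))), h1, ?_, ?_⟩, h2, ?_, ?_, c, ?_, h3⟩
    · simp only; positivity
    · exact (min_le_left _ _).trans_lt (by linarith)
    · exact min_le_left _ _
    · exact (min_le_right _ _).trans (min_le_left _ _)
    · have : min (η/2) (min (r l / 4) (c / 8)) ≤ c / 8 := (min_le_right _ _).trans (min_le_right _ _)
      simp only; linarith
  choose g hg1 hg2 hg3 hg4 using step
  have h0 : Stage T A (0 : X) := by
    refine ⟨∅, fun l z ε hε => ?_, 0, by simp, by simp⟩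
    simpa using hA l
  let s : ℕ → St := fun k => Nat.rec (motive := fun _ => St)
    ⟨(0, 1/2), h0, by norm_num, by norm_num⟩ (fun l p => g l p) k
  have hs : ∀ k, s (k+1) = g k (s k) := fun k => rfl
  have hpos : ∀ k, 0 < (s k).1.2 := fun k => (s k).2.2.1
  have hlt : ∀ k, (s k).1.2 < 1 := fun k => (s k).2.2.2
  have hQ : ∀ k, QSmall T ((s (k+1)).1.1 - (s k).1.1) (s k).1.2 := fun k => by rw [hs]; exact hg1 _ _
  have hhalf : ∀ k, (s (k+1)).1.2 ≤ (s k).1.2 / 2 := fun k => by rw [hs]; exact hg2 _ _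
  have hQ' : ∀ k j, QSmall T ((s (k+j)).1.1 - (s k).1.1) (2 * (s k).1.2 - 2 * (s (k+j)).1.2) := by
    intro k j
    induction j with
    | zero => simpa using QSmall.zero T
    | succ j ih =>
      have h1 := ih.add (hQ (k+j))
      rw [add_comm, sub_add_sub_cancel] at h1
      exact h1.mono (by have := hhalf (k+j); rw [← add_assoc]; linarith)
  have hgeo : ∀ k, (s k).1.2 ≤ (1/2) * (1/2)^k := by
    intro k
    induction k with
    | zero => simp [s]
    | succ k ih => have := hhalf k; rw [pow_succ]; linarith
  have hcau : CauchySeq fun k => (s k).1.1 := by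
    refine cauchySeq_of_le_geometric (1/2) (1/2) (by norm_num) fun k => ?_
    rw [dist_comm, dist_eq_norm]
    exact ((hQ k).norm_le (hlt k)).trans (hgeo k)
  obtain ⟨x, hx⟩ := cauchySeq_tendsto_of_complete hcau
  have hlim : ∀ k, QSmall T (x - (s k).1.1) (2 * (s k).1.2) := by
    intro k
    refine QSmall.lim (u := fun j => (s j).1.1 - (s k).1.1) ?_ (hx.sub_const _)
    filter_upwards [eventually_ge_atTop k] with j hj
    obtain ⟨i, rfl⟩ := Nat.exists_eq_add_of_le hj
    exact (hQ' k i).mono (by have := hpos (k+i); linarith)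
  refine ⟨x, fun l => ?_⟩
  obtain ⟨c, hc, hev⟩ := hg4 l (s l)
  rw [← hs] at hc hev
  refine pos_lowerDensity_of_diff (B := {n | 2 * (s (l+1)).1.2 < ‖(T ^ n) (x - (s (l+1)).1.1)‖})
    (ρ := 2 * (s (l+1)).1.2) ?_ ?_ hev (hlim (l+1)) ?_
  · have := hpos (l+1); linarith
  · have := hpos (l+1); linarith
  · rintro n ⟨hn, hn1⟩ hn2
    refine ⟨hn, ?_⟩
    have h3 : (s (l+1)).1.2 ≤ r l / 4 := by rw [hs]; exact hg3 _ _
    have hn2 : ‖(T ^ n) (x - (s (l+1)).1.1)‖ ≤ 2 * (s (l+1)).1.2 := not_lt.1 hn2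
    have e : (T ^ n) x - a l = (T ^ n) (x - (s (l+1)).1.1) + ((T ^ n) (s (l+1)).1.1 - a l) := by
      rw [map_sub]; abel
    rw [e]
    exact (norm_add_le _ _).trans_lt (by linarith)

open MeasureTheory in
lemma dense_good [TopologicalSpace.SeparableSpace X] (T : X →L[ℂ] X) (I : Type) (E : I → ℝ → X)
    (heig : ∀ (i : I) (t : ℝ),
      T (E i t) = Complex.exp (2 * Real.pi * Complex.I * t) • E i t)
    (hspan : ∀ N : Set ℝ, MeasurableSet N → MeasureTheory.volume N = 0 →
      Dense (Submodule.span ℂ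
        {x : X | ∃ i : I, ∃ t ∈ Set.Ico (0 : ℝ) 1 \ N, x = E i t} : Set X)) :
    Dense (Submodule.span ℂ {e | GoodVec T e} : Set X) := by
  let Z : X → ℝ → Set (AddCircle (1:ℝ)) := fun e ε => {t | ∃ e', ‖e' - e‖ < ε ∧
    T e' = (AddCircle.toCircle t : ℂ) • e'}
  let d := TopologicalSpace.denseSeq X
  let B : ℕ × ℕ → Set (AddCircle (1:ℝ)) := fun p =>
    if volume (Z (d p.1) (1 / ((p.2:ℝ)+1))) = 0 then Z (d p.1) (1 / ((p.2:ℝ)+1)) else ∅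
  have hB : ∀ p, volume (B p) = 0 := by
    intro p; simp only [B]; split_ifs with h
    · exact h
    · simp
  have hU : volume (⋃ p, B p) = 0 := measure_iUnion_null hB
  set U := toMeasurable volume (⋃ p, B p) with hUdef
  have hU' : volume U = 0 := by rw [hUdef, measure_toMeasurable, hU]
  have hUm : MeasurableSet U := measurableSet_toMeasurable _ _
  have hmp := AddCircle.measurePreserving_mk (1:ℝ) 0
  have hpre : volume.restrict (Ioc (0:ℝ) (0+1)) ((fun t : ℝ => (t : AddCircle (1:ℝ))) ⁻¹' U) = 0 := by
    rw [hmp.measure_preimage hUm.nullMeasurableSet, hU']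
  have hmm : MeasurableSet ((fun t : ℝ => (t : AddCircle (1:ℝ))) ⁻¹' U) := hmp.measurable hUm
  rw [Measure.restrict_apply hmm, zero_add] at hpre
  refine (hspan (((fun t : ℝ => (t : AddCircle (1:ℝ))) ⁻¹' U) ∩ Ioc 0 1 ∪ {0})
    ((hmm.inter measurableSet_Ioc).union (measurableSet_singleton _)) ?_).mono ?_
  · refine measure_union_null hpre (by simp)
  · apply Submodule.span_mono
    rintro _ ⟨i, t, ⟨⟨ht0, ht1⟩, htN⟩, rfl⟩
    simp only [mem_union, mem_inter_iff, mem_preimage, mem_Ioc, mem_singleton_iff, not_or, not_and] at htN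
    have htU : (t : AddCircle (1:ℝ)) ∉ U := fun h =>
      htN.1 h (lt_of_le_of_ne ht0 (Ne.symm htN.2)) ht1.le
    intro ε hε hzero
    obtain ⟨q, hq⟩ := exists_nat_one_div_lt (half_pos hε)
    obtain ⟨j, hj⟩ := (TopologicalSpace.denseRange_denseSeq X).exists_dist_lt (E i t)
      (show (0:ℝ) < 1 / ((q:ℝ)+1) by positivity)
    apply htU
    apply subset_toMeasurable
    rw [mem_iUnion]
    refine ⟨(j, q), ?_⟩
    have hnull : volume (Z (d j) (1 / ((q:ℝ)+1))) = 0 := by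
      refine measure_mono_null ?_ hzero
      rintro u ⟨e', h1, h2⟩
      refine ⟨e', ?_, h2⟩
      rw [← dist_eq_norm] at h1 ⊢
      refine (dist_triangle _ (d j) _).trans_lt ?_
      rw [dist_comm] at hj
      linarith
    simp only [B]
    rw [if_pos hnull]
    refine ⟨E i t, ?_, ?_⟩
    · rw [← dist_eq_norm]; exact hj
    · rw [heig, AddCircle.toCircle_apply_mk, Circle.coe_exp]
      congr 2
      push_cast
      ring

end final

/-- Let `T` be a bounded operator on a separable complex Banach space `X` admitting a
countable `λ`-spanning family of `𝕋`-eigenvector fields (here parametrised by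
`t ↦ exp(2πit)`, `t ∈ [0,1)`, so that `λ` corresponds to Lebesgue measure on `[0,1)`).
If `X` has type `2`, or `X` has type `p ∈ [1,2)` and each field is `αᵢ`-Hölderian with
`αᵢ > 1/p − 1/2`, then `T` is hereditarily frequently hypercyclic. -/
theorem hereditarilyFrequentlyHypercyclic_of_spanning_eigenvector_fields
    {X : Type*} [NormedAddCommGroup X] [NormedSpace ℂ X] [CompleteSpace X]
    [TopologicalSpace.SeparableSpace X]
    (T : X →L[ℂ] X) (I : Type) [Countable I]
    (E : I → ℝ → X)
    (hbdd : ∀ i, ∃ C : ℝ, ∀ t : ℝ, ‖E i t‖ ≤ C)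
    (heig : ∀ (i : I) (t : ℝ),
      T (E i t) = Complex.exp (2 * Real.pi * Complex.I * t) • E i t)
    (hspan : ∀ N : Set ℝ, MeasurableSet N → MeasureTheory.volume N = 0 →
      Dense (Submodule.span ℂ
        {x : X | ∃ i : I, ∃ t ∈ Set.Ico (0 : ℝ) 1 \ N, x = E i t} : Set X))
    (htype : HasRademacherType X 2 ∨
      ∃ p : ℝ, 1 ≤ p ∧ p < 2 ∧ HasRademacherType X p ∧
        ∀ i : I, ∃ α : ℝ, 1 / p - 1 / 2 < α ∧
          ∃ C : ℝ, ∀ s t : ℝ, ‖E i s - E i t‖ ≤ C * |s - t| ^ α) :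
    HereditarilyFrequentlyHypercyclic T := by
  intro I' _ V A hVo hVn hA
  have hd := dense_good T I E heig hspan
  rcases isEmpty_or_nonempty I' with hI | hI
  · exact ⟨0, fun i => hI.elim i⟩
  obtain ⟨φ, hφ⟩ := exists_surjective_nat I'
  have hball : ∀ i, ∃ a : X, ∃ r : ℝ, 0 < r ∧ Metric.ball a r ⊆ V i := fun i => by
    obtain ⟨a, ha⟩ := hVn i
    obtain ⟨r, hr, hb⟩ := Metric.isOpen_iff.1 (hVo i) a ha
    exact ⟨a, r, hr, hb⟩
  choose a r hr hb using hball
  obtain ⟨x, hx⟩ := hfh_of_dense_good hd (fun l => A (φ l)) (fun l => hA _) (fun l => a (φ l))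
    (fun l => r (φ l)) (fun l => hr _)
  refine ⟨x, fun i => ?_⟩
  obtain ⟨l, rfl⟩ := hφ i
  refine pos_lowerDensity_mono ?_ (hx l)
  rintro n ⟨h1, h2⟩
  refine ⟨hb _ ?_, h1⟩
  rw [Metric.mem_ball, dist_eq_norm]
  exact h2
end

section
/- Let 1 ≤ p < ∞. There exist a bounded linear operator T on ℓ_p(ℤ₊) and a set A ⊆ ℕ with positive lower density such that T is frequently hypercyclic and chaotic, but T is not frequently hypercyclic along A (and thus T is not hereditarily frequently hypercyclic). -/
open Filter Topology Set
open scoped Classical ENNReal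

/-- `T` is frequently hypercyclic. -/
def FrequentlyHypercyclic {X : Type*} [TopologicalSpace X] [AddCommGroup X] [Module ℂ X]
    (T : X →L[ℂ] X) : Prop :=
  ∃ x : X, ∀ V : Set X, IsOpen V → V.Nonempty → 0 < lowerDensity (visitSet T x V)

/-- `T` is frequently hypercyclic along `A`: some vector `x` is such that
`N_T(x,V) ∩ A` has positive lower density for every non-empty open `V`. -/
def FrequentlyHypercyclicAlong {X : Type*} [TopologicalSpace X] [AddCommGroup X]
    [Module ℂ X] (T : X →L[ℂ] X) (A : Set ℕ) : Prop :=
  ∃ x : X, ∀ V : Set X, IsOpen V → V.Nonempty → 0 < lowerDensity (visitSet T x V ∩ A)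

/-- `T` is chaotic: hypercyclic with a dense set of periodic points. -/
def Chaotic {X : Type*} [TopologicalSpace X] [AddCommGroup X] [Module ℂ X]
    (T : X →L[ℂ] X) : Prop :=
  (∃ x : X, Dense (Set.range fun n : ℕ => (T ^ n) x)) ∧
  Dense {x : X | ∃ n : ℕ, 0 < n ∧ (T ^ n) x = x}


namespace FH

def aa (n : ℕ) : ℕ := (n + 4) ^ 2
def Dl (n : ℕ) : ℕ := 2 ^ aa n
def LL (n : ℕ) : ℕ := 2 ^ (n ^ 2 + 8 * n + 12)
def dl (n : ℕ) : ℕ := 2 * LL n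
def Q (n : ℕ) : ℕ := 2 ^ ((n + 3) ^ 2 + 1)
def tau (n : ℕ) : ℕ := 2 * Q n + 2 * aa n + 2 * n + 6
def b (n : ℕ) : ℕ := ∑ i ∈ Finset.range n, Dl i

lemma Dl_eq (n : ℕ) : Dl n = 16 * LL n := by
  unfold Dl LL aa
  rw [show (n + 4) ^ 2 = 4 + (n ^ 2 + 8 * n + 12) by ring, pow_add]; norm_num
lemma Dl_eq' (n : ℕ) : Dl n = 8 * dl n := by rw [Dl_eq]; unfold dl; ring
lemma LL_pos (n : ℕ) : 0 < LL n := by unfold LL; positivity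
lemma Dl_pos (n : ℕ) : 0 < Dl n := by unfold Dl; positivity
lemma Q_pos (n : ℕ) : 0 < Q n := by unfold Q; positivity
lemma dl_pos (n : ℕ) : 0 < dl n := by have := LL_pos n; unfold dl; omega
lemma Q_succ (n : ℕ) : Q (n + 1) = 2 * Dl n := by
  unfold Q Dl aa; rw [pow_succ]; ring_nf
lemma Q_dvd_Dl (n : ℕ) : Q n ∣ Dl n := by
  unfold Q Dl aa; apply pow_dvd_pow; ring_nf; omega
lemma Q_dvd_Q {m n : ℕ} (h : m ≤ n) : Q m ∣ Q n := by
  unfold Q; apply pow_dvd_pow; gcongr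
lemma Dl_succ (n : ℕ) : Dl (n + 1) = 2 ^ (2 * n + 9) * Dl n := by
  unfold Dl aa; rw [← pow_add]; congr 1; ring
lemma Dl_succ_ge (n : ℕ) : 512 * (n + 1) * Dl n ≤ Dl (n + 1) := by
  rw [Dl_succ]
  gcongr
  have h : n < 2 ^ n := Nat.lt_two_pow_self
  calc 512 * (n + 1) ≤ 2 ^ 9 * 2 ^ (2 * n) := by
        have : 2 ^ n ≤ 2 ^ (2 * n) := Nat.pow_le_pow_right (by norm_num) (by omega)
        omega
    _ = _ := by rw [← pow_add]; congr 1; ring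
lemma Dl_succ_ge' (n : ℕ) : 512 * Dl n ≤ Dl (n + 1) := by
  have := Dl_succ_ge n
  nlinarith [Nat.zero_le (n * Dl n)]
lemma Dl_mono : StrictMono Dl := by
  apply strictMono_nat_of_lt_succ
  intro n; have := Dl_succ_ge' n; have := Dl_pos n; omega
lemma LL_mono : Monotone LL := by
  intro m n h
  have := Dl_mono.monotone h
  rw [Dl_eq, Dl_eq] at this; omega
lemma lt_Dl (n : ℕ) : n < Dl n := by
  have : n < 2 ^ n := Nat.lt_two_pow_self
  have h2 : 2 ^ n ≤ Dl n := by unfold Dl aa; exact Nat.pow_le_pow_right (by norm_num) (by nlinarith)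
  omega
lemma tau_le (n : ℕ) : tau n + n + 1 ≤ LL n := by
  have h1 : 4 * Q n ≤ LL n := by
    unfold Q LL
    rw [show (4:ℕ) = 2 ^ 2 by norm_num, ← pow_add]
    exact Nat.pow_le_pow_right (by norm_num) (by nlinarith)
  have h2 : 2 * (2 * aa n + 3 * n + 7) ≤ LL n := by
    unfold LL aa
    have : n ^ 2 + 8 * n < 2 ^ (n ^ 2 + 8 * n) := Nat.lt_two_pow_self
    rw [pow_add]
    nlinarith
  unfold tau; omega
lemma b_succ (n : ℕ) : b (n + 1) = b n + Dl n := by unfold b; rw [Finset.sum_range_succ]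
lemma b_zero : b 0 = 0 := rfl
lemma b_strictMono : StrictMono b := by
  apply strictMono_nat_of_lt_succ
  intro n; have := Dl_pos n; rw [b_succ]; omega
lemma b_le_Dl (n : ℕ) : b n ≤ Dl n := by
  induction n with
  | zero => simp [b_zero]
  | succ n ih => rw [b_succ]; have := Dl_succ_ge' n; omega
lemma le_b (n : ℕ) : n ≤ b n := b_strictMono.id_le n

def blk (k : ℕ) : ℕ := Nat.findGreatest (fun n => b n ≤ k) k
lemma b_blk_le (k : ℕ) : b (blk k) ≤ k :=
  Nat.findGreatest_spec (P := fun n => b n ≤ k) (Nat.zero_le k) (by simp [b_zero])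
lemma lt_b_blk (k : ℕ) : k < b (blk k + 1) := by
  by_contra h
  push Not at h
  have := Nat.le_findGreatest (P := fun n => b n ≤ k) ((le_b _).trans h) h
  change blk k + 1 ≤ blk k at this
  omega
lemma blk_eq {n k : ℕ} (h1 : b n ≤ k) (h2 : k < b (n + 1)) : blk k = n := by
  have h3 := b_blk_le k
  have h4 := lt_b_blk k
  have h5 : n < blk k + 1 := b_strictMono.lt_iff_lt.1 (h1.trans_lt h4)
  have h6 : blk k < n + 1 := b_strictMono.lt_iff_lt.1 (h3.trans_lt h2)
  omega
lemma blk_add {n i : ℕ} (h : i < Dl n) : blk (b n + i) = n :=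
  blk_eq (by omega) (by rw [b_succ]; omega)
lemma blk_lt_iff {n k : ℕ} : blk k < n ↔ k < b n := by
  constructor
  · intro h
    exact (lt_b_blk k).trans_le (b_strictMono.monotone h)
  · intro h
    exact b_strictMono.lt_iff_lt.1 ((b_blk_le k).trans_lt h)
/-- position inside the block -/
def pos (k : ℕ) : ℕ := k - b (blk k)
lemma pos_add {n i : ℕ} (h : i < Dl n) : pos (b n + i) = i := by
  unfold pos; rw [blk_add h]; omega
lemma b_pos (k : ℕ) : b (blk k) + pos k = k := by
  unfold pos; have := b_blk_le k; omega
lemma pos_lt (k : ℕ) : pos k < Dl (blk k) := by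
  have := lt_b_blk k; rw [b_succ] at this; have := b_pos k; omega

noncomputable def vv (n : ℕ) : ℝ := 1 / 2 ^ tau n
noncomputable def kap (n : ℕ) : ℝ := 2 ^ tau n / 2 ^ dl n
/-- weight -/
noncomputable def om (n i : ℕ) : ℝ := 2 ^ (min i (dl n))
noncomputable def beta (j : ℕ) : ℝ := 1 / ((j : ℝ) + 1) ^ 2

lemma vv_pos (n : ℕ) : 0 < vv n := by unfold vv; positivity
lemma kap_pos (n : ℕ) : 0 < kap n := by unfold kap; positivity
lemma om_pos (n i : ℕ) : 0 < om n i := by unfold om; positivity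
lemma om_le (n i : ℕ) : om n i ≤ 2 ^ dl n := by
  unfold om; exact pow_le_pow_right₀ (by norm_num) (min_le_right _ _)
lemma om_eq {n i : ℕ} (h : dl n ≤ i) : om n i = 2 ^ dl n := by
  unfold om; rw [min_eq_right h]
lemma kap_om {n r : ℕ} (h : r ≤ LL n) : kap n * om n r ≤ (1 / 2) ^ (n + 1) := by
  have h1 := tau_le n
  have : om n r ≤ 2 ^ LL n := by
    unfold om; exact pow_le_pow_right₀ (by norm_num) ((min_le_left _ _).trans h)
  have h2 : kap n * om n r ≤ kap n * 2 ^ LL n := by gcongr; exact (kap_pos n).le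
  refine h2.trans ?_
  unfold kap dl
  rw [two_mul, pow_add, div_mul_eq_mul_div, one_div, inv_pow, ← one_div, div_le_div_iff₀ (by positivity) (by positivity)]
  have h3 : (2:ℝ) ^ tau n * 2 ^ (n + 1) ≤ 2 ^ LL n := by
    rw [← pow_add]; exact pow_le_pow_right₀ (by norm_num) (by omega)
  have h4 : (0:ℝ) < 2 ^ LL n := by positivity
  nlinarith
lemma kap_le (n : ℕ) : kap n ≤ (1 / 2) ^ (n + 1) := by
  have := kap_om (n := n) (r := 0) (Nat.zero_le _)
  simpa [om] using this
lemma beta_summable : Summable beta := by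
  unfold beta
  have := (summable_nat_add_iff 1).2 (Real.summable_one_div_nat_pow.2 (by norm_num : 1 < 2))
  simpa using this
lemma beta_nonneg (j : ℕ) : 0 ≤ beta j := by unfold beta; positivity
lemma vv_beta {j : ℕ} : vv (blk j) * 3 ^ Q (blk j) * (blk j + 2) ≤ beta j := by
  set m := blk j
  have h1 : j + 1 ≤ 2 * Dl m := by
    have := lt_b_blk j; rw [b_succ] at this; have := b_le_Dl m; simp only [m] at *; omega
  have h2 : ((j:ℝ) + 1) ≤ 2 * 2 ^ aa m := by
    have : ((j + 1 : ℕ) : ℝ) ≤ ((2 * Dl m : ℕ) : ℝ) := by exact_mod_cast h1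
    simpa [Dl] using this
  have h3 : (3:ℝ) ^ Q m ≤ 2 ^ (2 * Q m) := by
    rw [pow_mul]; exact pow_le_pow_left₀ (by norm_num) (by norm_num) _
  have h4 : ((m:ℝ) + 2) ≤ 2 ^ (m + 1) := by
    have : m + 1 < 2 ^ (m + 1) := Nat.lt_two_pow_self
    exact_mod_cast this
  unfold vv beta
  rw [div_mul_eq_mul_div, div_mul_eq_mul_div, one_mul, div_le_div_iff₀ (by positivity) (by positivity)]
  calc (3:ℝ) ^ Q m * (m + 2) * (j + 1) ^ 2 ≤ 2 ^ (2 * Q m) * 2 ^ (m + 1) * (2 * 2 ^ aa m) ^ 2 := by gcongr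
    _ = 2 ^ (2 * Q m + (m + 1) + (1 + aa m) * 2) := by ring
    _ ≤ 2 ^ tau m := by
        apply pow_le_pow_right₀ (by norm_num); unfold tau; omega
    _ = _ := by ring
lemma vv_le (n : ℕ) : vv n * (n + 2) ≤ (1 / 2) ^ (n + 1) := by
  have h4 : ((n:ℝ) + 2) ≤ 2 ^ (n + 1) := by
    have : n + 1 < 2 ^ (n + 1) := Nat.lt_two_pow_self
    exact_mod_cast this
  unfold vv
  rw [div_mul_eq_mul_div, one_mul, one_div, inv_pow, ← one_div, div_le_div_iff₀ (by positivity) (by positivity)]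
  calc ((n:ℝ) + 2) * 2 ^ (n + 1) ≤ 2 ^ (n + 1) * 2 ^ (n + 1) := by gcongr
    _ = 2 ^ (2 * n + 2) := by rw [← pow_add]; congr 1; ring
    _ ≤ 2 ^ tau n := by apply pow_le_pow_right₀ (by norm_num); unfold tau; omega
    _ = _ := by ring
lemma geo_hasSum : HasSum (fun n : ℕ => ((1:ℝ) / 2) ^ (n + 1)) 1 := by
  have := hasSum_geometric_two.mul_left (1/2:ℝ)
  simpa [pow_succ, mul_comm] using this

attribute [irreducible] aa Dl LL dl Q tau b blk pos

end FH

namespace FH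
set_option linter.unusedSectionVars false

variable {p : ℝ≥0∞} [hp1 : Fact (1 ≤ p)]

noncomputable abbrev X (p : ℝ≥0∞) : Type := lp (fun _ : ℕ => ℂ) p

noncomputable def e (p : ℝ≥0∞) (k : ℕ) : X p := lp.single p k (1 : ℂ)

lemma e_self (k : ℕ) : (e p k) k = 1 := lp.single_apply_self (E := fun _ : ℕ => ℂ) p k (1:ℂ)
lemma e_ne {j k : ℕ} (h : j ≠ k) : (e p k) j = 0 := lp.single_apply_ne (E := fun _ : ℕ => ℂ) p k (1:ℂ) h
lemma norm_e {p : ℝ≥0∞} [hp1 : Fact (1 ≤ p)] (k : ℕ) : ‖e p k‖ = 1 := by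
  unfold e; rw [lp.norm_single (zero_lt_one.trans_le hp1.out)]; simp

def rho (k : ℕ) : ℕ := if pos k = 0 then b (blk k + 1) - 1 else k - 1
def nxt (j : ℕ) : ℕ := if pos j + 1 = Dl (blk j) then b (blk j) else j + 1
noncomputable def wt (k : ℕ) : ℂ :=
  if pos k = 0 then -(1 / 2 ^ dl (blk k)) else if pos k ≤ dl (blk k) then 2 else 1

lemma exists_pos (k : ℕ) : ∃ n i, i < Dl n ∧ k = b n + i := ⟨blk k, pos k, pos_lt k, (b_pos k).symm⟩

lemma nxt_rho (k : ℕ) : nxt (rho k) = k := by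
  obtain ⟨n, i, hi, rfl⟩ := exists_pos k
  unfold rho
  rw [pos_add hi, blk_add hi]
  split_ifs with h
  · subst h
    have : b (n + 1) - 1 = b n + (Dl n - 1) := by rw [b_succ]; omega
    unfold nxt
    rw [this, pos_add (by omega), blk_add (by omega), if_pos (by omega)]; rfl
  · have : b n + i - 1 = b n + (i - 1) := by omega
    unfold nxt
    rw [this, pos_add (by omega), blk_add (by omega), if_neg (by omega)]; omega

lemma rho_inj : Function.Injective rho := Function.LeftInverse.injective nxt_rho

lemma wt_norm (k : ℕ) : ‖wt k‖ ≤ 2 := by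
  unfold wt
  split_ifs
  · rw [norm_neg, norm_div, norm_pow]; simp
    have : ((2:ℝ) ^ dl (blk k))⁻¹ ≤ 1 := inv_le_one_of_one_le₀ (one_le_pow₀ (by norm_num))
    linarith
  · simp
  · simp

lemma toReal_pos' (hp : p ≠ ∞) : 0 < p.toReal :=
  ENNReal.toReal_pos (zero_lt_one.trans_le hp1.out).ne' hp

lemma S_le (hp : p ≠ ∞) (x : X p) (k : ℕ) : ‖wt k * x (rho k)‖ ^ p.toReal ≤ 2 ^ p.toReal * ‖x (rho k)‖ ^ p.toReal := by
  rw [← Real.mul_rpow (by norm_num) (norm_nonneg _)]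
  apply Real.rpow_le_rpow (norm_nonneg _) _ (toReal_pos' hp).le
  rw [norm_mul]
  gcongr
  exact wt_norm k

lemma S_sum (hp : p ≠ ∞) (x : X p) : Summable (fun k => 2 ^ p.toReal * ‖x (rho k)‖ ^ p.toReal) :=
  (((lp.memℓp x).summable (toReal_pos' hp)).comp_injective rho_inj).mul_left _

lemma S_mem (hp : p ≠ ∞) (x : X p) : Memℓp (fun k => wt k * x (rho k)) p := by
  apply memℓp_gen
  exact Summable.of_nonneg_of_le (fun k => by positivity) (S_le hp x) (S_sum hp x)

noncomputable def Slin (hp : p ≠ ∞) : X p →ₗ[ℂ] X p where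
  toFun x := ⟨fun k => wt k * x (rho k), S_mem hp x⟩
  map_add' x y := by ext k; exact mul_add _ _ _
  map_smul' c x := by ext k; simp; ring

lemma Slin_apply (hp : p ≠ ∞) (x : X p) (k : ℕ) : Slin hp x k = wt k * x (rho k) := rfl

lemma Slin_norm (hp : p ≠ ∞) (x : X p) : ‖Slin hp x‖ ≤ 2 * ‖x‖ := by
  have h0 := toReal_pos' hp
  apply lp.norm_le_of_tsum_le h0 (by positivity)
  rw [Real.mul_rpow (by norm_num) (norm_nonneg _), lp.norm_rpow_eq_tsum h0, ← tsum_mul_left]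
  have hs := ((lp.memℓp x).summable h0).mul_left (2 ^ p.toReal)
  calc ∑' k, ‖Slin hp x k‖ ^ p.toReal ≤ ∑' k, 2 ^ p.toReal * ‖x (rho k)‖ ^ p.toReal := by
        apply Summable.tsum_le_tsum (S_le hp x) _ (S_sum hp x)
        exact Summable.of_nonneg_of_le (fun k => by positivity) (S_le hp x) (S_sum hp x)
    _ ≤ _ := by
        exact (S_sum hp x).tsum_le_tsum_of_inj rho rho_inj (fun c _ => by positivity) (fun k => le_rfl) hs

noncomputable def S (hp : p ≠ ∞) : X p →L[ℂ] X p := (Slin hp).mkContinuous 2 (Slin_norm hp)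

lemma S_apply (hp : p ≠ ∞) (x : X p) (k : ℕ) : S hp x k = wt k * x (rho k) := rfl

lemma S_e (hp : p ≠ ∞) (k : ℕ) : S hp (e p (rho k)) = wt k • e p k := by
  ext k'
  rw [S_apply, lp.coeFn_smul, Pi.smul_apply, smul_eq_mul]
  by_cases h : k' = k
  · subst h; rw [e_self, e_self]
  · rw [e_ne h, e_ne (fun h' => h (rho_inj h'))]; simp

noncomputable def u (g : ℕ → X p) (n : ℕ) : X p :=
  g n - ∑ i ∈ Finset.range n, (kap i : ℂ) • e p (b i)

structure Good (g : ℕ → X p) : Prop where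
  supp : ∀ n k, b n ≤ k → g n k = 0
  norm : ∀ n, ‖g n‖ ≤ n + 1

def Supp (n : ℕ) (y : X p) : Prop := ∀ k, b n ≤ k → y k = 0

lemma Supp.add {n : ℕ} {y z : X p} (hy : Supp n y) (hz : Supp n z) : Supp n (y + z) := by
  intro k hk; rw [lp.coeFn_add, Pi.add_apply, hy k hk, hz k hk, add_zero]
lemma Supp.smul {n : ℕ} {y : X p} (c : ℂ) (hy : Supp n y) : Supp n (c • y) := by
  intro k hk; rw [lp.coeFn_smul, Pi.smul_apply, hy k hk, smul_zero]
lemma Supp.sum {n : ℕ} {ι : Type*} (s : Finset ι) (f : ι → X p) (h : ∀ i ∈ s, Supp n (f i)) : Supp n (∑ i ∈ s, f i) := by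
  intro k hk
  rw [lp.coeFn_sum, Finset.sum_apply]
  exact Finset.sum_eq_zero (fun i hi => h i hi k hk)
lemma Supp.mono {m n : ℕ} (h : m ≤ n) {y : X p} (hy : Supp m y) : Supp n y :=
  fun k hk => hy k ((b_strictMono.monotone h).trans hk)
lemma supp_e {n k : ℕ} (h : k < b n) : Supp n (e p k) := fun j hj => e_ne (by omega)

lemma Supp.eq_sum {n : ℕ} {y : X p} (hy : Supp n y) : y = ∑ k ∈ Finset.range (b n), y k • e p k := by
  ext j
  rw [lp.coeFn_sum, Finset.sum_apply]
  by_cases h : j < b n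
  · rw [Finset.sum_eq_single j]
    · simp [e_self]
    · intro k _ hk; simp [e_ne hk.symm]
    · intro h'; simp at h'; omega
  · rw [hy j (by omega), Finset.sum_eq_zero]
    intro k hk
    simp at hk
    rw [lp.coeFn_smul, Pi.smul_apply, e_ne (by omega), smul_zero]

lemma u_supp {g : ℕ → X p} (hg : Good g) (n : ℕ) : Supp n (u g n) := by
  intro k hk
  unfold u
  rw [lp.coeFn_sub, Pi.sub_apply, hg.supp n k hk, Supp.sum (n := n) _ _ _ k hk, sub_zero]
  intro i hi
  apply Supp.smul
  exact supp_e (b_strictMono (Finset.mem_range.1 hi))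

lemma norm_kap (n : ℕ) : ‖((kap n : ℝ) : ℂ)‖ = kap n := by
  rw [Complex.norm_real, Real.norm_of_nonneg (kap_pos n).le]
lemma norm_vv (n : ℕ) : ‖((vv n : ℝ) : ℂ)‖ = vv n := by
  rw [Complex.norm_real, Real.norm_of_nonneg (vv_pos n).le]

lemma sum_geo_le (s : Finset ℕ) : ∑ i ∈ s, ((1:ℝ) / 2) ^ (i + 1) ≤ 1 :=
  sum_le_hasSum s (fun i _ => by positivity) geo_hasSum

lemma u_norm {g : ℕ → X p} (hg : Good g) (n : ℕ) : ‖u g n‖ ≤ n + 2 := by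
  unfold u
  have h1 : ‖∑ i ∈ Finset.range n, (kap i : ℂ) • e p (b i)‖ ≤ 1 := by
    refine (norm_sum_le _ _).trans (le_trans (Finset.sum_le_sum (fun i _ => ?_)) (sum_geo_le (Finset.range n)))
    rw [norm_smul, norm_e, mul_one, norm_kap]
    exact kap_le i
  have := norm_sub_le (g n) (∑ i ∈ Finset.range n, (kap i : ℂ) • e p (b i))
  have := hg.norm n
  linarith

noncomputable def Rn (g : ℕ → X p) (n : ℕ) : X p →L[ℂ] X p :=
  (vv n : ℂ) • (lp.evalCLM ℂ (fun _ : ℕ => ℂ) p (b (n + 1) - 1)).smulRight (u g n)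

lemma Rn_apply (g : ℕ → X p) (n : ℕ) (x : X p) : Rn g n x = (vv n : ℂ) • (x (b (n + 1) - 1) • u g n) := rfl

lemma Rn_norm {g : ℕ → X p} (hg : Good g) (n : ℕ) : ‖Rn g n‖ ≤ (1 / 2) ^ (n + 1) := by
  apply ContinuousLinearMap.opNorm_le_bound _ (by positivity)
  intro x
  rw [Rn_apply, norm_smul, norm_smul, norm_vv]
  have h1 : ‖x (b (n + 1) - 1)‖ ≤ ‖x‖ := lp.norm_apply_le_norm (zero_lt_one.trans_le hp1.out).ne' x _
  have h2 := u_norm hg n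
  calc vv n * (‖x (b (n + 1) - 1)‖ * ‖u g n‖) ≤ vv n * (‖x‖ * (n + 2)) := by
        gcongr; exact (vv_pos n).le
    _ = vv n * (n + 2) * ‖x‖ := by ring
    _ ≤ _ := by gcongr; exact vv_le n

lemma R_summable {g : ℕ → X p} (hg : Good g) : Summable (Rn g) :=
  Summable.of_norm_bounded geo_hasSum.summable (Rn_norm hg)

noncomputable def T (hp : p ≠ ∞) (g : ℕ → X p) : X p →L[ℂ] X p := S hp + ∑' n, Rn g n

lemma T_norm (hp : p ≠ ∞) {g : ℕ → X p} (hg : Good g) : ‖T hp g‖ ≤ 3 := by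
  unfold T
  have h1 : ‖S hp‖ ≤ 2 := LinearMap.mkContinuous_norm_le _ (by norm_num) _
  have h2 : ‖∑' n, Rn g n‖ ≤ 1 := tsum_of_norm_bounded geo_hasSum (Rn_norm hg)
  have := norm_add_le (S hp) (∑' n, Rn g n)
  linarith

lemma R_apply {g : ℕ → X p} (hg : Good g) (x : X p) : HasSum (fun n => Rn g n x) ((∑' n, Rn g n) x) :=
  (R_summable hg).hasSum.mapL (ContinuousLinearMap.apply ℂ (X p) x)

lemma T_e_mid (hp : p ≠ ∞) {g : ℕ → X p} (hg : Good g) {n i : ℕ} (h : i + 1 < Dl n) :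
    T hp g (e p (b n + i)) = (if i + 1 ≤ dl n then (2:ℂ) else 1) • e p (b n + (i + 1)) := by
  unfold T
  rw [_root_.add_apply]
  have h1 : rho (b n + (i + 1)) = b n + i := by
    unfold rho; rw [pos_add h, if_neg (by omega)]; omega
  have h2 : wt (b n + (i + 1)) = (if i + 1 ≤ dl n then (2:ℂ) else 1) := by
    unfold wt; rw [pos_add h, if_neg (by omega), blk_add h]
  have h3 := S_e hp (b n + (i + 1))
  rw [h1, h2] at h3
  rw [h3]
  have h4 : (∑' n, Rn g n) (e p (b n + i)) = 0 := by
    refine (R_apply hg _).unique ?_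
    convert hasSum_zero with m
    rw [Rn_apply, e_ne, zero_smul, smul_zero]
    intro h5
    have h6 : b (m + 1) - 1 = b m + (Dl m - 1) := by rw [b_succ]; have := Dl_pos m; omega
    rw [h6] at h5
    have h7 := congrArg blk h5
    have := Dl_pos m
    rw [blk_add (by omega), blk_add (by omega)] at h7
    subst h7
    omega
  rw [h4, add_zero]

lemma T_e_last (hp : p ≠ ∞) {g : ℕ → X p} (hg : Good g) {n i : ℕ} (h : i + 1 = Dl n) :
    T hp g (e p (b n + i)) = (-(1 / 2 ^ dl n) : ℂ) • e p (b n) + (vv n : ℂ) • u g n := by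
  unfold T
  rw [_root_.add_apply]
  have hp0 : pos (b n) = 0 := pos_add (n := n) (i := 0) (Dl_pos n)
  have hb0 : blk (b n) = n := blk_add (n := n) (i := 0) (Dl_pos n)
  have h1 : rho (b n) = b n + i := by
    unfold rho; rw [hp0, if_pos rfl, hb0, b_succ]; omega
  have h2 : wt (b n) = -(1 / 2 ^ dl n) := by
    unfold wt; rw [hp0, if_pos rfl, hb0]
  have h3 := S_e hp (b n)
  rw [h1, h2] at h3
  rw [h3]
  congr 1
  refine (R_apply hg _).unique ?_
  have h4 : Rn g n (e p (b n + i)) = (vv n : ℂ) • u g n := by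
    rw [Rn_apply, show b (n + 1) - 1 = b n + i by rw [b_succ]; omega, e_self, one_smul]
  rw [← h4]
  apply hasSum_single
  intro m hm
  rw [Rn_apply, e_ne, zero_smul, smul_zero]
  intro h5
  have h6 : b (m + 1) - 1 = b m + (Dl m - 1) := by rw [b_succ]; have := Dl_pos m; omega
  rw [h6] at h5
  have h7 := congrArg blk h5
  have := Dl_pos m
  rw [blk_add (by omega), blk_add (by omega)] at h7
  exact hm h7

end FH

namespace FH
set_option linter.unusedSectionVars false

variable {p : ℝ≥0∞} [hp1 : Fact (1 ≤ p)]

lemma pow_add_apply (A : X p →L[ℂ] X p) (m n : ℕ) (x : X p) : (A ^ (m + n)) x = (A ^ m) ((A ^ n) x) := by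
  rw [pow_add]; rfl
lemma pow_succ_apply (A : X p →L[ℂ] X p) (m : ℕ) (x : X p) : (A ^ (m + 1)) x = A ((A ^ m) x) := by
  rw [pow_succ']; rfl
lemma pow_zero_apply (A : X p →L[ℂ] X p) (x : X p) : (A ^ 0) x = x := by
  rw [pow_zero]; rfl

lemma pow_fix_mul (A : X p →L[ℂ] X p) {q : ℕ} {x : X p} (h : (A ^ q) x = x) (s : ℕ) : (A ^ (s * q)) x = x := by
  induction s with
  | zero => simp
  | succ s ih => rw [Nat.succ_mul, pow_add_apply, h, ih]
lemma pow_fix_dvd (A : X p →L[ℂ] X p) {q Q : ℕ} {x : X p} (h : (A ^ q) x = x) (hd : q ∣ Q) : (A ^ Q) x = x := by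
  obtain ⟨s, rfl⟩ := hd
  rw [mul_comm]; exact pow_fix_mul A h s

variable (hp : p ≠ ∞) {g : ℕ → X p} (hg : Good g)

lemma T_pow_e0 (hg : Good g) {n m : ℕ} (h : m < Dl n) :
    (T hp g ^ m) (e p (b n)) = (om n m : ℂ) • e p (b n + m) := by
  induction m with
  | zero => simp [om]
  | succ m ih =>
    rw [pow_succ_apply, ih (by omega), map_smul, T_e_mid hp hg h, smul_smul]
    congr 1
    unfold om
    split_ifs with h1
    · rw [min_eq_left h1, min_eq_left (by omega)]; push_cast; ring
    · rw [min_eq_right (by omega), min_eq_right (by omega)]; push_cast; ring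

lemma T_pow_Dl (hg : Good g) (n : ℕ) :
    (T hp g ^ Dl n) (e p (b n)) = - e p (b n) + ((2 ^ dl n * vv n : ℝ) : ℂ) • u g n := by
  have h0 := Dl_pos n
  obtain ⟨i, hi⟩ : ∃ i, i + 1 = Dl n := ⟨Dl n - 1, by omega⟩
  have h1 : dl n ≤ i := by have := Dl_eq' n; have := dl_pos n; omega
  rw [← hi, pow_succ_apply, T_pow_e0 hp hg (by omega), map_smul, T_e_last hp hg hi, om_eq h1, smul_add,
    smul_smul, smul_smul]
  congr 1
  · have : ((2 ^ dl n : ℝ) : ℂ) * -(1 / 2 ^ dl n) = -1 := by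
      push_cast; field_simp
    rw [this, neg_one_smul]
  · push_cast; rfl

lemma T_Supp (hg : Good g) {n : ℕ} {y : X p} (hy : Supp n y) : Supp n (T hp g y) := by
  rw [hy.eq_sum, map_sum]
  apply Supp.sum
  intro k hk
  rw [map_smul]
  apply Supp.smul
  simp at hk
  obtain ⟨m, i, hi, rfl⟩ := exists_pos k
  have hm : m < n := by
    have := blk_lt_iff.2 hk; rwa [blk_add hi] at this
  have h2 : b m + Dl m ≤ b n := by rw [← b_succ]; exact b_strictMono.monotone hm
  by_cases h : i + 1 = Dl m
  · rw [T_e_last hp hg h]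
    refine Supp.add (Supp.smul _ (supp_e (by omega))) (Supp.smul _ ?_)
    exact (u_supp hg m).mono hm.le
  · rw [T_e_mid hp hg (by omega)]
    exact Supp.smul _ (supp_e (by omega))

lemma T_pow_Supp (hg : Good g) {n : ℕ} {y : X p} (hy : Supp n y) (t : ℕ) : Supp n ((T hp g ^ t) y) := by
  induction t with
  | zero => simpa using hy
  | succ t ih => rw [pow_succ_apply]; exact T_Supp hp hg ih

lemma e_eq (hg : Good g) {n i : ℕ} (h : i < Dl n) :
    e p (b n + i) = ((om n i : ℂ))⁻¹ • (T hp g ^ i) (e p (b n)) := by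
  rw [T_pow_e0 hp hg h, smul_smul, inv_mul_cancel₀, one_smul]
  exact_mod_cast (om_pos n i).ne'

lemma T_pow_Q (hg : Good g) (n : ℕ) : ∀ y : X p, Supp n y → (T hp g ^ Q n) y = y := by
  induction n with
  | zero =>
    intro y hy
    have : y = 0 := by
      rw [hy.eq_sum]; simp [b_zero]
    rw [this, map_zero]
  | succ n ih =>
    intro y hy
    have key : (T hp g ^ Q (n + 1)) (e p (b n)) = e p (b n) := by
      have hu : (T hp g ^ Dl n) (u g n) = u g n :=
        pow_fix_dvd _ (ih _ (u_supp hg n)) (Q_dvd_Dl n)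
      rw [Q_succ, two_mul, pow_add_apply, T_pow_Dl hp hg, map_add, map_neg, T_pow_Dl hp hg, map_smul, hu]
      abel
    rw [hy.eq_sum, map_sum]
    refine Finset.sum_congr rfl (fun k hk => ?_)
    rw [map_smul]
    congr 1
    simp at hk
    obtain ⟨m, i, hi, rfl⟩ := exists_pos k
    have hm : m < n + 1 := by
      have := blk_lt_iff.2 hk; rwa [blk_add hi] at this
    rcases Nat.lt_succ_iff_lt_or_eq.1 hm with h | rfl
    · refine pow_fix_dvd _ (ih _ (supp_e ?_)) (Q_dvd_Q (by omega))
      have : b m + Dl m ≤ b n := by rw [← b_succ]; exact b_strictMono.monotone h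
      omega
    · rw [e_eq hp hg hi, map_smul, ← pow_add_apply, add_comm, pow_add_apply, key]

lemma T_pow_Dl_fix (hg : Good g) {n : ℕ} {y : X p} (hy : Supp n y) (s : ℕ) : (T hp g ^ (s * Dl n)) y = y :=
  pow_fix_mul _ (pow_fix_dvd _ (T_pow_Q hp hg n y hy) (Q_dvd_Dl n)) s

lemma T_pow_s (hg : Good g) (n s : ℕ) :
    (T hp g ^ (s * Dl n)) (e p (b n)) = ((-1) ^ s : ℂ) • e p (b n) +
      (if Odd s then ((2 ^ dl n * vv n : ℝ) : ℂ) else 0) • u g n := by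
  induction s with
  | zero => simp
  | succ s ih =>
    rw [Nat.succ_mul, add_comm, pow_add_apply, ih, map_add, map_smul, map_smul, T_pow_Dl hp hg]
    have hu := T_pow_Dl_fix hp hg (u_supp hg n) 1
    rw [one_mul] at hu
    rw [hu, pow_succ]
    rcases Nat.even_or_odd s with h | h
    · rw [if_neg (by simpa using h), if_pos h.add_one, h.neg_one_pow]; simp
    · rw [if_pos h, if_neg (by simpa using h.add_one), h.neg_one_pow]; simp

lemma T_pow_main (hg : Good g) {n r : ℕ} (s : ℕ) (h : r < Dl n) :
    (T hp g ^ (s * Dl n + r)) (e p (b n)) = ((-1) ^ s * (om n r : ℂ)) • e p (b n + r) +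
      (if Odd s then ((2 ^ dl n * vv n : ℝ) : ℂ) else 0) • (T hp g ^ r) (u g n) := by
  rw [add_comm, pow_add_apply, T_pow_s hp hg, map_add, map_smul, map_smul, T_pow_e0 hp hg h, smul_smul]

lemma norm_T_pow (hg : Good g) (t : ℕ) (y : X p) : ‖(T hp g ^ t) y‖ ≤ 3 ^ t * ‖y‖ := by
  induction t with
  | zero => simp
  | succ t ih =>
    rw [pow_succ_apply, pow_succ']
    refine (ContinuousLinearMap.le_opNorm _ _).trans ?_
    rw [mul_assoc]
    exact mul_le_mul (T_norm hp hg) ih (norm_nonneg _) (by norm_num)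

lemma norm_T_pow_u (hg : Good g) (n r : ℕ) : ‖(T hp g ^ r) (u g n)‖ ≤ 3 ^ Q n * (n + 2) := by
  have h1 : (T hp g ^ r) (u g n) = (T hp g ^ (r % Q n)) (u g n) := by
    conv_lhs => rw [← Nat.mod_add_div r (Q n)]
    rw [pow_add_apply, pow_fix_dvd _ (T_pow_Q hp hg n _ (u_supp hg n)) (Dvd.intro _ rfl)]
  rw [h1]
  refine (norm_T_pow hp hg _ _).trans ?_
  have h2 := u_norm hg n
  have h3 : r % Q n ≤ Q n := (Nat.mod_lt _ (Q_pos n)).le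
  gcongr
  norm_num

lemma coord_le (x : X p) (k : ℕ) : ‖x k‖ ≤ ‖x‖ :=
  lp.norm_apply_le_norm (zero_lt_one.trans_le hp1.out).ne' x _

lemma T_pow_e (hg : Good g) {m i : ℕ} (hi : i < Dl m) (t : ℕ) :
    (T hp g ^ t) (e p (b m + i)) = ((om m i : ℂ))⁻¹ •
      (((-1) ^ ((t + i) / Dl m) * (om m ((t + i) % Dl m) : ℂ)) • e p (b m + (t + i) % Dl m) +
      (if Odd ((t + i) / Dl m) then ((2 ^ dl m * vv m : ℝ) : ℂ) else 0) •
        (T hp g ^ ((t + i) % Dl m)) (u g m)) := by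
  rw [← T_pow_main hp hg _ (Nat.mod_lt _ (Dl_pos m)), Nat.div_add_mod', e_eq hp hg hi, map_smul, ← pow_add_apply]

lemma T_pow_e_coord (hg : Good g) {m i : ℕ} (hi : i < Dl m) (t k : ℕ) :
    ((T hp g ^ t) (e p (b m + i))) k = ((om m i : ℂ))⁻¹ *
      (((-1) ^ ((t + i) / Dl m) * (om m ((t + i) % Dl m) : ℂ)) * (e p (b m + (t + i) % Dl m)) k +
      (if Odd ((t + i) / Dl m) then ((2 ^ dl m * vv m : ℝ) : ℂ) else 0) *
        ((T hp g ^ ((t + i) % Dl m)) (u g m)) k) := by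
  rw [T_pow_e hp hg hi]; rfl

/-- Coordinates in higher blocks vanish. -/
lemma T_pow_e_zero (hg : Good g) {j k : ℕ} (h : blk j < blk k) (t : ℕ) : ((T hp g ^ t) (e p j)) k = 0 := by
  apply T_pow_Supp hp hg (n := blk k) (supp_e (blk_lt_iff.1 h))
  exact b_blk_le k

/-- Coordinates in the own block. -/
lemma T_pow_e_own (hg : Good g) {m i : ℕ} (hi : i < Dl m) (t r : ℕ) :
    ((T hp g ^ t) (e p (b m + i))) (b m + r) =
      if r = (t + i) % Dl m then ((om m i : ℂ))⁻¹ * ((-1) ^ ((t + i) / Dl m) * (om m r : ℂ)) else 0 := by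
  rw [T_pow_e_coord hp hg hi]
  have h1 : ((T hp g ^ ((t + i) % Dl m)) (u g m)) (b m + r) = 0 :=
    T_pow_Supp hp hg (u_supp hg m) _ _ (by omega)
  rw [h1, mul_zero, add_zero]
  by_cases h : r = (t + i) % Dl m
  · rw [if_pos h, ← h, e_self]; ring
  · rw [if_neg h, e_ne (by omega)]; simp

lemma T_pow_e_far (hg : Good g) {m i k : ℕ} (hi : i < Dl m) (t : ℕ) (hk : k < b m) :
    ‖((T hp g ^ t) (e p (b m + i))) k‖ ≤ 2 ^ dl m / om m i * beta (b m + i) := by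
  rw [T_pow_e_coord hp hg hi]
  rw [e_ne (by omega), mul_zero, zero_add, norm_mul, norm_inv, norm_mul, Complex.norm_real, Real.norm_of_nonneg (om_pos m i).le]
  have h1 := (coord_le ((T hp g ^ ((t + i) % Dl m)) (u g m)) k).trans (norm_T_pow_u hp hg _ _)
  have h2 : ‖(if Odd ((t + i) / Dl m) then ((2 ^ dl m * vv m : ℝ) : ℂ) else 0)‖ ≤ 2 ^ dl m * vv m := by
    have := vv_pos m
    split_ifs
    · rw [Complex.norm_real, Real.norm_of_nonneg (by positivity)]
    · simp; positivity
  have h3 := vv_beta (j := b m + i)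
  rw [blk_add hi] at h3
  have h4 := om_pos m i
  calc _ ≤ (om m i)⁻¹ * ((2 ^ dl m * vv m) * (3 ^ Q m * (m + 2))) := by
        gcongr
        have := vv_pos m; positivity
    _ = 2 ^ dl m / om m i * (vv m * 3 ^ Q m * (m + 2)) := by ring
    _ ≤ _ := by gcongr

lemma T_pow_e_early (hg : Good g) {m i k : ℕ} (hi : i < Dl m) (t : ℕ) (ht : t + i < Dl m) (hk : k < b m) :
    ((T hp g ^ t) (e p (b m + i))) k = 0 := by
  rw [T_pow_e_coord hp hg hi, Nat.div_eq_of_lt ht]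
  rw [e_ne (by omega)]
  simp

lemma T_pow_hasSum (x : X p) (t k : ℕ) :
    HasSum (fun j => x j * ((T hp g ^ t) (e p j)) k) (((T hp g ^ t) x) k) := by
  have h1 := lp.hasSum_single hp x
  have h2 := h1.mapL ((lp.evalCLM ℂ (fun _ : ℕ => ℂ) p k).comp (T hp g ^ t))
  have h3 : (fun j => x j * ((T hp g ^ t) (e p j)) k) =
      fun j => ((lp.evalCLM ℂ (fun _ : ℕ => ℂ) p k).comp (T hp g ^ t)) (lp.single p j (x j)) := by
   funext j
   have : lp.single p j (x j) = x j • e p j := by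
     unfold e
     rw [← lp.single_smul]; simp
   rw [this, map_smul]; rfl
  rw [h3]; exact h2

end FH

namespace FH
set_option linter.unusedSectionVars false

noncomputable def cnt (A : Set ℕ) (N : ℕ) : ℕ := ((Finset.Icc 1 N).filter (· ∈ A)).card

lemma cnt_le (A : Set ℕ) (N : ℕ) : cnt A N ≤ N := by
  unfold cnt
  refine (Finset.card_filter_le _ _).trans ?_
  simp

lemma cnt_mono {A B : Set ℕ} {M N : ℕ} (hMN : M ≤ N) (h : ∀ t, 1 ≤ t → t ≤ M → t ∈ A → t ∈ B) :
    cnt A M ≤ cnt B N := by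
  unfold cnt
  apply Finset.card_le_card
  intro t ht
  simp only [Finset.mem_filter, Finset.mem_Icc] at ht ⊢
  exact ⟨⟨ht.1.1, ht.1.2.trans hMN⟩, h t ht.1.1 ht.1.2 ht.2⟩

lemma cnt_eq_zero {A : Set ℕ} (h : ∀ t, t ∉ A) (N : ℕ) : cnt A N = 0 := by
  unfold cnt
  rw [Finset.card_eq_zero, Finset.filter_eq_empty_iff]
  exact fun t _ => h t

lemma ratio_le (A : Set ℕ) (N : ℕ) : ((cnt A N : ℕ) : ℝ) / N ≤ 1 := by
  have : (cnt A N : ℝ) ≤ N := by exact_mod_cast cnt_le A N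
  exact div_le_one_of_le₀ this (by positivity)

lemma ld_pos {A : Set ℕ} {c : ℝ} (hc : 0 < c) {N0 : ℕ} (h : ∀ N ≥ N0, c * N ≤ cnt A N) : 0 < lowerDensity A := by
  refine hc.trans_le ?_
  unfold lowerDensity
  refine le_liminf_of_le ?_ ?_
  · apply Filter.IsBoundedUnder.isCoboundedUnder_ge
    exact ⟨1, Filter.eventually_map.2 (Filter.Eventually.of_forall fun N => ratio_le A N)⟩
  · filter_upwards [eventually_ge_atTop N0, eventually_gt_atTop 0] with N h1 h2
    rw [le_div_iff₀ (by exact_mod_cast h2)]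
    exact h N h1

lemma ld_exists {A : Set ℕ} (h : 0 < lowerDensity A) : ∃ c : ℝ, 0 < c ∧ ∃ N0 : ℕ, ∀ N ≥ N0, c * N ≤ cnt A N := by
  refine ⟨lowerDensity A / 2, by linarith, ?_⟩
  have h1 : lowerDensity A / 2 < lowerDensity A := by linarith
  have h2 := eventually_lt_of_lt_liminf (f := atTop) h1
    ⟨0, Filter.eventually_map.2 (Filter.Eventually.of_forall fun N => by positivity)⟩
  obtain ⟨N0, hN0⟩ := eventually_atTop.1 h2
  refine ⟨N0 + 1, fun N hN => ?_⟩
  have h3 := hN0 N (by omega)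
  rw [lt_div_iff₀ (by exact_mod_cast (by omega : 0 < N))] at h3
  exact h3.le

lemma cnt_ge {q : ℕ} (hq : 0 < q) {R : Finset ℕ} (hR : ∀ r ∈ R, r < q) {P : Set ℕ} {N : ℕ} (hN : 2 * q ≤ N)
    (h : ∀ s ≥ 1, ∀ r ∈ R, s * q + r ≤ N → s * q + r ∈ P) : R.card * N ≤ 3 * q * cnt P N := by
  set K := N / q with hK
  have hK2 : 2 ≤ K := (Nat.le_div_iff_mul_le hq).2 hN
  have h1 : K * q ≤ N := Nat.div_mul_le_self N q
  have h2 : N < (K + 1) * q := by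
    have := Nat.lt_succ_iff.2 (le_refl (N / q))
    rwa [Nat.div_lt_iff_lt_mul hq] at this
  have h3 : ((Finset.Icc 1 (K - 1)) ×ˢ R).card ≤ cnt P N := by
    unfold cnt
    apply Finset.card_le_card_of_injOn (fun x => x.1 * q + x.2)
    · rintro ⟨s, r⟩ hx
      simp only [Finset.coe_product, Set.mem_prod, Finset.mem_coe, Finset.mem_Icc] at hx
      simp only [Finset.coe_filter, Set.mem_ofPred_eq, Finset.mem_Icc]
      have h4 := hR r hx.2
      have h5 : (s + 1) * q ≤ K * q := Nat.mul_le_mul_right _ (by omega)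
      have h6 : 1 * q ≤ s * q := Nat.mul_le_mul_right _ hx.1.1
      have h7 : s * q + r ≤ N := by rw [Nat.succ_mul] at h5; omega
      exact ⟨⟨by omega, h7⟩, h s hx.1.1 r hx.2 h7⟩
    · rintro ⟨s, r⟩ hx ⟨s', r'⟩ hx' heq
      simp only [Finset.coe_product, Set.mem_prod, Finset.mem_coe, Finset.mem_Icc] at hx hx'
      have h4 := hR r hx.2
      have h5 := hR r' hx'.2
      simp only at heq
      have h6 : r = r' := by
        have := congrArg (· % q) heq
        simpa [Nat.add_mod, Nat.mod_eq_of_lt h4, Nat.mod_eq_of_lt h5] using this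
      subst h6
      have h7 : s * q = s' * q := by omega
      have h8 := Nat.eq_of_mul_eq_mul_right hq h7
      rw [h8]
  rw [Finset.card_product, Nat.card_Icc] at h3
  have h4 : N ≤ 3 * q * (K - 1) := by
    obtain ⟨J, hJ⟩ : ∃ J, K = J + 2 := ⟨K - 2, by omega⟩
    rw [hJ] at h2 ⊢
    have : J + 2 - 1 = J + 1 := by omega
    rw [this]
    nlinarith [Nat.zero_le (J * q)]
  have h5 : K - 1 + 1 - 1 = K - 1 := by omega
  rw [h5] at h3
  calc R.card * N ≤ R.card * (3 * q * (K - 1)) := Nat.mul_le_mul_left _ h4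
    _ = 3 * q * ((K - 1) * R.card) := by ring
    _ ≤ _ := Nat.mul_le_mul_left _ h3

lemma exists_scale {N : ℕ} (h : 2 * Dl 0 ≤ N) : ∃ n, 2 * Dl n ≤ N ∧ N < 2 * Dl (n + 1) := by
  have hex : ∃ k, N < 2 * Dl k := ⟨N, by have := lt_Dl N; omega⟩
  have h1 := Nat.find_spec hex
  have h2 : Nat.find hex ≠ 0 := by
    intro h0; rw [h0] at h1; omega
  obtain ⟨n, hn⟩ := Nat.exists_eq_succ_of_ne_zero h2
  refine ⟨n, ?_, ?_⟩
  · have := Nat.find_min hex (m := n) (by omega)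
    omega
  · rw [hn] at h1; exact h1

def AA : Set ℕ := {t | ∀ n, Dl n ≤ t → t < dl (n + 1) → dl n ≤ t % Dl n ∧ t % Dl n < 7 * dl n}

lemma AA_pos : 0 < lowerDensity AA := by
  apply ld_pos (c := 1 / 12) (by norm_num) (N0 := 2 * Dl 0)
  intro N hN
  obtain ⟨n, h1, h2⟩ := exists_scale hN
  have h0 := Dl_succ_ge' n
  have hD := Dl_pos n
  have hd := dl_pos n
  have hDd := Dl_eq' n
  set N' := min N (Dl (n + 1) - 1) with hN'
  have h3 : 2 * Dl n ≤ N' := by omega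
  have h4 : N ≤ 3 * N' := by omega
  have h5 : N' < Dl (n + 1) := by omega
  have h6 := cnt_ge (q := Dl n) hD (R := Finset.Ico (dl n) (7 * dl n)) (P := AA) (N := N')
    (by intro r hr; simp at hr; omega) h3 (by
      intro s hs r hr hle m hm1 hm2
      simp only [Finset.mem_Ico] at hr
      have h7 : Dl n ≤ s * Dl n + r := by
        have : 1 * Dl n ≤ s * Dl n := Nat.mul_le_mul_right _ hs
        omega
      have h8 : m < n + 1 := Dl_mono.lt_iff_lt.1 (by omega)
      have h9 : n < m + 1 := by
        apply Dl_mono.lt_iff_lt.1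
        have := Dl_eq' (m + 1)
        omega
      have : m = n := by omega
      subst this
      have : (s * Dl m + r) % Dl m = r := by
        rw [Nat.mul_add_mod', Nat.mod_eq_of_lt (by omega)]
      rw [this]; exact hr)
  have h7 : cnt AA N' ≤ cnt AA N := cnt_mono (by omega) (fun t _ _ h => h)
  rw [Nat.card_Ico, hDd] at h6
  have h8 : (6 * dl n) * N' ≤ (6 * dl n) * (4 * cnt AA N') := by
    have : 7 * dl n - dl n = 6 * dl n := by omega
    rw [this] at h6
    calc _ ≤ _ := h6
      _ = _ := by ring
  have h9 : N' ≤ 4 * cnt AA N' := Nat.le_of_mul_le_mul_left h8 (by omega)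
  have h10 : N ≤ 12 * cnt AA N := by omega
  have : (N:ℝ) ≤ 12 * cnt AA N := by exact_mod_cast h10
  linarith

variable {p : ℝ≥0∞} [hp1 : Fact (1 ≤ p)]
variable (hp : p ≠ ∞) {g : ℕ → X p}

noncomputable def hh (x : X p) (j : ℕ) : ℝ := ‖x j‖ * (2 ^ dl (blk j) / om (blk j) (pos j))

lemma hh_nonneg (x : X p) (j : ℕ) : 0 ≤ hh x j := by
  unfold hh; have := om_pos (blk j) (pos j); positivity

lemma bounded_case (hg : Good g) (x : X p) {B : ℝ} (hB : ∀ j, hh x j ≤ B) : ∃ C : ℝ, ∀ t, ‖((T hp g ^ t) x) 0‖ ≤ C := by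
  have hB0 : 0 ≤ B := (hh_nonneg x 0).trans (hB 0)
  have hs : Summable (fun j => if j < b 1 then (1:ℝ) else 0) := by
    apply summable_of_ne_finset_zero (s := Finset.range (b 1))
    intro j hj
    simp at hj
    rw [if_neg (by omega)]
  have hs2 := (hs.add beta_summable).mul_left B
  refine ⟨_, fun t => (T_pow_hasSum hp x t 0).norm_le_of_bounded hs2.hasSum (fun j => ?_)⟩
  rw [norm_mul]
  obtain ⟨m, i, hi, rfl⟩ := exists_pos j
  have h1 := hB (b m + i)
  unfold hh at h1
  rw [blk_add hi, pos_add hi] at h1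
  have h2 := om_pos m i
  suffices h3 : ‖((T hp g ^ t) (e p (b m + i))) 0‖ ≤ 2 ^ dl m / om m i * ((if b m + i < b 1 then (1:ℝ) else 0) + beta (b m + i)) by
    calc _ ≤ ‖x (b m + i)‖ * (2 ^ dl m / om m i * ((if b m + i < b 1 then (1:ℝ) else 0) + beta (b m + i))) := by gcongr
      _ = (‖x (b m + i)‖ * (2 ^ dl m / om m i)) * ((if b m + i < b 1 then (1:ℝ) else 0) + beta (b m + i)) := by ring
      _ ≤ _ := by
        gcongr
        have := beta_nonneg (b m + i)
        split_ifs <;> linarith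
  have hb := beta_nonneg (b m + i)
  rcases Nat.eq_zero_or_pos m with rfl | hm
  · have h4 := T_pow_e_own hp hg hi t 0
    rw [b_zero] at h4 ⊢
    rw [h4]
    have : 0 + i < b 1 := by
      have := b_succ 0
      rw [b_zero] at this; simp only [Nat.zero_add] at this ⊢; omega
    rw [if_pos this]
    have h5 : (1:ℝ) ≤ 1 + beta (0 + i) := by rw [b_zero] at hb; linarith
    have h6 : ∀ q : ℝ, 0 ≤ q → q ≤ 2 ^ dl 0 / om 0 i → q ≤ 2 ^ dl 0 / om 0 i * (1 + beta (0 + i)) := by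
      intro q h0 h; nlinarith
    apply h6 _ (norm_nonneg _)
    split_ifs
    · rw [norm_mul, norm_mul, norm_inv, norm_pow, norm_neg, norm_one, one_pow, one_mul, Complex.norm_real, Complex.norm_real,
        Real.norm_of_nonneg h2.le, Real.norm_of_nonneg (om_pos _ _).le, inv_mul_eq_div]
      gcongr
      exact om_le _ _
    · rw [norm_zero]; positivity
  · have h4 : 0 < b m := by have := le_b m; omega
    refine (T_pow_e_far hp hg hi t h4).trans ?_
    gcongr
    split_ifs <;> linarith

lemma tail_small (x : X p) : ∃ n1, ∀ n ≥ n1, ‖x‖ * ∑' k, beta (k + b n) ≤ 1 / 2 := by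
  have h1 := (tendsto_sum_nat_add beta).const_mul ‖x‖
  rw [mul_zero] at h1
  have h2 := h1.eventually (ge_mem_nhds (show (0:ℝ) < 1/2 by norm_num))
  obtain ⟨n1, h3⟩ := eventually_atTop.1 h2
  exact ⟨n1, fun n hn => h3 _ (hn.trans (le_b n))⟩

lemma coord_small (x : X p) (hp : p ≠ ∞) : ∃ J, ∀ j ≥ J, ‖x j‖ < 1 := by
  have h1 := ((lp.memℓp x).summable (toReal_pos' hp)).tendsto_atTop_zero
  obtain ⟨J, hJ⟩ := eventually_atTop.1 (h1.eventually (gt_mem_nhds (show (0:ℝ) < 1 by norm_num)))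
  refine ⟨J, fun j hj => ?_⟩
  by_contra h
  push Not at h
  have := Real.one_le_rpow h (toReal_pos' hp).le
  linarith [hJ j hj]

lemma big_norm (hg : Good g) (x : X p) {n i0 : ℕ} (hi0 : i0 < dl n) (hh1 : 1 ≤ hh x (b n + i0))
    (htail : ‖x‖ * ∑' k, beta (k + b (n + 1)) ≤ 1 / 2) {t : ℕ} (ht2 : t < dl (n + 1))
    (hA1 : dl n ≤ t % Dl n) (hA2 : t % Dl n < 7 * dl n) : 1 / 2 ≤ ‖(T hp g ^ t) x‖ := by
  have hDd := Dl_eq' n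
  have hDi : i0 < Dl n := by omega
  set r := t % Dl n + i0 with hr
  have hrD : r < Dl n := by omega
  have hrt : r = (t + i0) % Dl n := by
    rw [Nat.add_mod, Nat.mod_eq_of_lt hDi, Nat.mod_eq_of_lt hrD]
  set k := b n + r with hk
  have hkblk : blk k = n := blk_add hrD
  refine le_trans ?_ (coord_le _ k)
  have hs := T_pow_hasSum (g := g) hp x t k
  have hs2 := hasSum_ite_sub_hasSum hs (b n + i0)
  let G : ℕ → ℝ := fun j => if j < b (n + 1) then 0 else ‖x‖ * beta j
  have hG : HasSum G (‖x‖ * ∑' k, beta (k + b (n + 1))) := by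
    have h1 : HasSum (fun k => G (k + b (n + 1))) (‖x‖ * ∑' k, beta (k + b (n + 1))) := by
      have : (fun k => G (k + b (n + 1))) = fun k => ‖x‖ * beta (k + b (n + 1)) := by
        funext k; simp only [G]; rw [if_neg (by omega)]
      rw [this]
      exact (((summable_nat_add_iff _).2 beta_summable).hasSum).mul_left _
    have h2 := (hasSum_nat_add_iff (b (n + 1))).1 h1
    rwa [Finset.sum_eq_zero, add_zero] at h2
    intro j hj
    simp at hj
    simp [G, hj]
  have hb := hs2.norm_le_of_bounded hG (fun j => by
    by_cases hj0 : j = b n + i0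
    · rw [if_pos hj0, norm_zero]
      simp only [G]
      split_ifs
      · rfl
      · have := beta_nonneg j; positivity
    · rw [if_neg hj0]
      obtain ⟨m, i, hi, rfl⟩ := exists_pos j
      rcases lt_trichotomy m n with hm | rfl | hm
      · have h1 : ((T hp g ^ t) (e p (b m + i))) k = 0 := by
          apply T_pow_e_zero hp hg
          rw [blk_add hi, hkblk]; exact hm
        have h2 : b m + i < b (n + 1) := by
          apply blk_lt_iff.1; rw [blk_add hi]; omega
        simp only [G]
        rw [h1, mul_zero, norm_zero, if_pos h2]
      · have h1 : ((T hp g ^ t) (e p (b m + i))) k = 0 := by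
          rw [hk, T_pow_e_own hp hg hi, if_neg]
          intro h3
          apply hj0
          rw [hrt] at h3
          have h4 : i0 % Dl m = i % Dl m := Nat.ModEq.add_left_cancel' t h3
          rw [Nat.mod_eq_of_lt hi, Nat.mod_eq_of_lt hDi] at h4
          rw [h4]
        have h2 : b m + i < b (m + 1) := by
          apply blk_lt_iff.1; rw [blk_add hi]; omega
        simp only [G]
        rw [h1, mul_zero, norm_zero, if_pos h2]
      · have h2 : ¬ b m + i < b (n + 1) := by
          intro h; have := blk_lt_iff.2 h; rw [blk_add hi] at this; omega
        simp only [G]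
        rw [if_neg h2]
        have hkm : k < b m := by apply blk_lt_iff.1; rw [hkblk]; exact hm
        have hbn := beta_nonneg (b m + i)
        by_cases he : t + i < Dl m
        · rw [T_pow_e_early hp hg hi t he hkm, mul_zero, norm_zero]; positivity
        · have h3 : Dl (n + 1) ≤ Dl m := Dl_mono.monotone hm
          have h4 := Dl_eq' (n + 1)
          have h5 := Dl_eq' m
          have h6 := T_pow_e_far hp hg hi t hkm
          rw [om_eq (by omega), div_self (by positivity), one_mul] at h6
          rw [norm_mul]
          gcongr
          exact coord_le x _)
  have h1 : ‖x (b n + i0) * ((T hp g ^ t) (e p (b n + i0))) k‖ = hh x (b n + i0) := by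
    rw [norm_mul, hk, T_pow_e_own hp hg hDi, if_pos hrt, hh, blk_add hDi, pos_add hDi, norm_mul, norm_mul, norm_inv, norm_pow,
      norm_neg, norm_one, one_pow, one_mul, Complex.norm_real, Complex.norm_real,
        Real.norm_of_nonneg (om_pos _ _).le, Real.norm_of_nonneg (om_pos _ _).le, inv_mul_eq_div, om_eq (i := r) (by omega)]
  have h2 := norm_sub_norm_le (x (b n + i0) * ((T hp g ^ t) (e p (b n + i0))) k) (((T hp g ^ t) x) k)
  rw [norm_sub_rev] at h2
  linarith

theorem not_FHC (hg : Good g) : ¬ FrequentlyHypercyclicAlong (T hp g) AA := by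
  rintro ⟨x, hx⟩
  by_cases hbd : ∃ B, ∀ j, hh x j ≤ B
  · obtain ⟨B, hB⟩ := hbd
    obtain ⟨C, hC⟩ := bounded_case hp hg x hB
    have hC0 : 0 ≤ C := (norm_nonneg _).trans (hC 0)
    have h1 := hx {y | C < ‖y 0‖} (by
      apply isOpen_lt continuous_const
      exact (lp.evalCLM ℂ (fun _ : ℕ => ℂ) p 0).continuous.norm) ⟨((C + 1 : ℝ) : ℂ) • e p 0, by
        have : (((C + 1 : ℝ) : ℂ) • e p 0) 0 = ((C + 1 : ℝ) : ℂ) * (e p 0) 0 := rfl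
        rw [Set.mem_ofPred_eq, this, e_self, mul_one, Complex.norm_real, Real.norm_of_nonneg (by linarith)]
        linarith⟩
    obtain ⟨c, hc, N0, hN0⟩ := ld_exists h1
    have h2 := hN0 (N0 + 1) (by omega)
    have h3 : cnt (visitSet (T hp g) x {y | C < ‖y 0‖} ∩ AA) (N0 + 1) = 0 := by
      apply cnt_eq_zero
      rintro t ⟨ht, _⟩
      exact absurd (hC t) (not_le.2 ht)
    rw [h3] at h2
    push_cast at h2
    have : 0 < c * ((N0:ℝ) + 1) := by positivity
    linarith
  · push Not at hbd
    have h1 := hx (Metric.ball 0 (1/2)) Metric.isOpen_ball ⟨0, by simp⟩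
    obtain ⟨c, hc, N0, hN0⟩ := ld_exists h1
    obtain ⟨n1, hn1⟩ := tail_small x
    obtain ⟨J, hJ⟩ := coord_small x hp
    obtain ⟨K, hK⟩ := exists_nat_gt (1 / c)
    set n2 := n1 + J + K + N0 + 1 with hn2
    obtain ⟨j, hj⟩ := hbd (1 + ∑ j ∈ Finset.range (b n2), hh x j)
    have hsum : 0 ≤ ∑ j ∈ Finset.range (b n2), hh x j := Finset.sum_nonneg (fun j _ => hh_nonneg x j)
    have hjb : b n2 ≤ j := by
      by_contra h
      have := Finset.single_le_sum (f := hh x) (fun j _ => hh_nonneg x j) (Finset.mem_range.2 (not_le.1 h))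
      linarith
    obtain ⟨n, i0, hi0, rfl⟩ := exists_pos j
    have hn : n2 ≤ n := by
      by_contra h
      have : blk (b n + i0) < n2 := by rw [blk_add hi0]; omega
      have := blk_lt_iff.1 this
      omega
    have hhj : 1 ≤ hh x (b n + i0) := by linarith
    have hnb := le_b n
    have hi0d : i0 < dl n := by
      by_contra h
      have h3 := hJ (b n + i0) (by omega)
      unfold hh at hhj
      rw [blk_add hi0, pos_add hi0, om_eq (not_lt.1 h), div_self (by positivity)] at hhj
      linarith
    have key : cnt (visitSet (T hp g) x (Metric.ball 0 (1/2)) ∩ AA) (dl (n + 1) - 1) ≤ Dl n := by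
      refine le_trans ?_ (cnt_le Set.univ (Dl n))
      unfold cnt
      apply Finset.card_le_card
      intro t ht
      simp only [Finset.mem_filter, Finset.mem_Icc] at ht ⊢
      refine ⟨⟨ht.1.1, ?_⟩, trivial⟩
      by_contra hlt
      push Not at hlt
      obtain ⟨hA1, hA2⟩ := ht.2.2 n hlt.le (by omega)
      have h3 := big_norm hp hg x hi0d hhj (hn1 (n + 1) (by omega)) (t := t) (by omega) hA1 hA2
      have h4 : (T hp g ^ t) x ∈ Metric.ball (0 : X p) (1/2) := ht.2.1
      rw [mem_ball_zero_iff] at h4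
      linarith
    have hD := Dl_succ_ge n
    have hd := Dl_eq' (n + 1)
    have hp' := Dl_pos n
    have hlt := lt_Dl n
    have h5 : (n + 1) * Dl n ≤ dl (n + 1) - 1 := by
      have : 64 * ((n + 1) * Dl n) ≤ dl (n + 1) := by
        have : 512 * ((n + 1) * Dl n) ≤ 8 * dl (n + 1) := by rw [← hd]; linarith
        omega
      have : 1 ≤ (n + 1) * Dl n := Nat.mul_pos (by omega) hp'
      omega
    have h6 := hN0 (dl (n + 1) - 1) (by nlinarith)
    have h7 : (((n + 1) * Dl n : ℕ) : ℝ) ≤ ((dl (n + 1) - 1 : ℕ) : ℝ) := by exact_mod_cast h5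
    have h8 : ((cnt (visitSet (T hp g) x (Metric.ball 0 (1/2)) ∩ AA) (dl (n + 1) - 1) : ℕ) : ℝ) ≤ Dl n := by exact_mod_cast key
    have h9 : c * (((n + 1) * Dl n : ℕ) : ℝ) ≤ Dl n := (mul_le_mul_of_nonneg_left h7 hc.le).trans (h6.trans h8)
    push_cast at h9
    have h10 : (0:ℝ) < Dl n := by exact_mod_cast hp'
    have h11 : c * ((n:ℝ) + 1) ≤ 1 := by
      have : (c * ((n:ℝ) + 1)) * Dl n ≤ 1 * Dl n := by linarith
      exact le_of_mul_le_mul_right this h10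
    have h12 : (K:ℝ) ≤ n := by exact_mod_cast (by omega : K ≤ n)
    rw [div_lt_iff₀ hc] at hK
    nlinarith

end FH

namespace FH
set_option linter.unusedSectionVars false

variable {p : ℝ≥0∞} [hp1 : Fact (1 ≤ p)]
variable (hp : p ≠ ∞) {g : ℕ → X p}

/-- Partial sums of the frequently hypercyclic vector. -/
noncomputable def yy (p : ℝ≥0∞) (n : ℕ) : X p := ∑ i ∈ Finset.range n, (kap i : ℂ) • e p (b i)

lemma yy_supp (n : ℕ) : Supp n (yy p n) := by
  apply Supp.sum
  intro i hi
  exact (supp_e (b_strictMono (Finset.mem_range.1 hi))).smul _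

lemma yy_succ (n : ℕ) : yy p (n + 1) = yy p n + (kap n : ℂ) • e p (b n) := Finset.sum_range_succ _ _

lemma kap_vv (n : ℕ) : kap n * (2 ^ dl n * vv n) = 1 := by
  unfold kap vv; field_simp

noncomputable def xx (p : ℝ≥0∞) [hp1 : Fact (1 ≤ p)] : X p := ∑' i, (kap i : ℂ) • e p (b i)

lemma xx_hasSum : HasSum (fun i => (kap i : ℂ) • e p (b i)) (xx p) := by
  apply Summable.hasSum
  apply Summable.of_norm_bounded geo_hasSum.summable
  intro i
  rw [norm_smul, norm_e, mul_one, norm_kap]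
  exact kap_le i

lemma geo_tail (n : ℕ) : HasSum (fun i : ℕ => ((1:ℝ) / 2) ^ (i + n + 1)) ((1 / 2) ^ n) := by
  have := geo_hasSum.mul_left (((1:ℝ) / 2) ^ n)
  rw [mul_one] at this
  refine this.congr_fun ?_
  intro i; rw [← pow_add]; congr 1; ring

lemma tail_le (hg : Good g) {n t : ℕ} (ht : t ≤ LL n) :
    ‖(T hp g ^ t) (xx p) - (T hp g ^ t) (yy p n)‖ ≤ (1 / 2) ^ n := by
  have h1 := (hasSum_nat_add_iff' n).2 (xx_hasSum (p := p))
  have h2 := h1.mapL (T hp g ^ t)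
  rw [map_sub] at h2
  refine h2.norm_le_of_bounded (geo_tail n) (fun i => ?_)
  have h3 : t ≤ LL (i + n) := ht.trans (LL_mono (by omega))
  have h4 := Dl_eq (i + n)
  have h5 := LL_pos (i + n)
  rw [map_smul, T_pow_e0 hp hg (by omega), norm_smul, norm_smul, norm_e, mul_one, norm_kap, Complex.norm_real,
    Real.norm_of_nonneg (om_pos _ _).le]
  exact kap_om h3

def HH (hp : p ≠ ∞) (g : ℕ → X p) (d : X p) (N0 n : ℕ) : Set ℕ :=
  {t | ‖(T hp g ^ t) (yy p (n + 1)) - d‖ ≤ (1 / 2) ^ N0 - (1 / 2) ^ (n + 1)}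

lemma T_pow_yy (hg : Good g) {n s r : ℕ} (hr : r ≤ LL n) :
    ‖(T hp g ^ (s * Dl n + r)) (yy p (n + 1)) - (if Odd s then (T hp g ^ r) (g n) else (T hp g ^ r) (yy p n))‖
      ≤ (1 / 2) ^ (n + 1) := by
  have h4 := Dl_eq n
  have h5 := LL_pos n
  have h1 : (T hp g ^ (s * Dl n + r)) (yy p (n + 1)) = (if Odd s then (T hp g ^ r) (g n) else (T hp g ^ r) (yy p n)) +
      ((kap n : ℂ) * ((-1) ^ s * (om n r : ℂ))) • e p (b n + r) := by
    rw [yy_succ, map_add, map_smul, T_pow_main hp hg s (by omega), add_comm (s * Dl n) r, pow_add_apply,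
      T_pow_Dl_fix hp hg (yy_supp n), smul_add, smul_smul, smul_smul]
    split_ifs with h
    · have h6 : (kap n : ℂ) * ((2 ^ dl n * vv n : ℝ) : ℂ) = 1 := by exact_mod_cast kap_vv n
      have h7 : u g n = g n - yy p n := rfl
      rw [h6, one_smul, h7, map_sub]
      abel
    · rw [mul_zero, zero_smul, add_zero]
  rw [h1, add_sub_cancel_left, norm_smul, norm_e, mul_one, norm_mul, norm_mul, norm_pow, norm_neg, norm_one, one_pow, one_mul,
    norm_kap, Complex.norm_real, Real.norm_of_nonneg (om_pos _ _).le]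
  exact kap_om hr

lemma claimA (hg : Good g) {d : X p} {l N0 n s r : ℕ} (hn : N0 ≤ n) (hd : Supp l d) (hgn : g n = d) (hs : Odd s)
    (hr : r ≤ LL n) (hl : Q l ∣ r) : s * Dl n + r ∈ HH hp g d N0 n := by
  have h1 := T_pow_yy hp hg (s := s) hr
  rw [if_pos hs, hgn, pow_fix_dvd _ (T_pow_Q hp hg l d hd) hl] at h1
  have h2 : ((1:ℝ) / 2) ^ n ≤ (1 / 2) ^ N0 := pow_le_pow_of_le_one (by norm_num) (by norm_num) hn
  have h3 : ((1:ℝ) / 2) ^ (n + 1) = (1 / 2) ^ n / 2 := by rw [pow_succ]; ring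
  change (_:ℝ) ≤ _
  linarith

lemma claimB (hg : Good g) {d : X p} {N0 n s r : ℕ} (hs : ¬ Odd s)
    (hr : r ≤ LL (n + 1)) (h : r ∈ HH hp g d N0 n) : s * Dl (n + 1) + r ∈ HH hp g d N0 (n + 1) := by
  have h1 := T_pow_yy hp hg (s := s) hr
  rw [if_neg hs] at h1
  have h3 : ((1:ℝ) / 2) ^ (n + 1 + 1) = (1 / 2) ^ (n + 1) / 2 := by rw [pow_succ]; ring
  have h4 : ‖(T hp g ^ r) (yy p (n + 1)) - d‖ ≤ (1 / 2) ^ N0 - (1 / 2) ^ (n + 1) := h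
  have h5 := norm_sub_le_norm_sub_add_norm_sub ((T hp g ^ (s * Dl (n + 1) + r)) (yy p (n + 1 + 1))) ((T hp g ^ r) (yy p (n + 1))) d
  change (_:ℝ) ≤ _
  linarith

lemma claimC (hg : Good g) {d : X p} {N0 n t : ℕ} (ht : t ≤ LL (n + 1)) (h : t ∈ HH hp g d N0 n) :
    ‖(T hp g ^ t) (xx p) - d‖ ≤ (1 / 2) ^ N0 := by
  have h1 := tail_le hp hg ht
  have h4 : ‖(T hp g ^ t) (yy p (n + 1)) - d‖ ≤ (1 / 2) ^ N0 - (1 / 2) ^ (n + 1) := h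
  have h5 := norm_sub_le_norm_sub_add_norm_sub ((T hp g ^ t) (xx p)) ((T hp g ^ t) (yy p (n + 1))) d
  linarith

def PP (hp : p ≠ ∞) (g : ℕ → X p) (d : X p) (N0 n : ℕ) (δ : ℝ) : Prop :=
  ∀ N, 4 * Dl n ≤ N → δ * N ≤ cnt (HH hp g d N0 n) N

lemma PP_start (hg : Good g) {d : X p} {l N0 n : ℕ} (hn : N0 ≤ n) (hd : Supp l d) (hgn : g n = d) :
    PP hp g d N0 n (1 / (96 * Q l)) := by
  intro N hN
  have hQ := Q_pos l
  have hD := Dl_pos n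
  have hDL := Dl_eq n
  have hL := LL_pos n
  set K := LL n / Q l + 1 with hK
  have h1 : ∀ k < K, k * Q l ≤ LL n := by
    intro k hk
    exact (Nat.mul_le_mul_right _ (by omega)).trans (Nat.div_mul_le_self (LL n) (Q l))
  have h2 : LL n ≤ K * Q l := by
    rw [hK]
    have := Nat.lt_div_mul_add (a := LL n) hQ
    rw [Nat.succ_mul]; omega
  have h3 := cnt_ge (q := 2 * Dl n) (by omega) (R := (Finset.range K).image (fun k => Dl n + k * Q l))
    (P := HH hp g d N0 n) (N := N) (by
      intro r hr
      obtain ⟨k, hk, rfl⟩ := Finset.mem_image.1 hr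
      have := h1 k (Finset.mem_range.1 hk)
      omega) (by omega) (by
      intro s _ r hr _
      obtain ⟨k, hk, rfl⟩ := Finset.mem_image.1 hr
      have h4 := h1 k (Finset.mem_range.1 hk)
      have h5 : s * (2 * Dl n) + (Dl n + k * Q l) = (2 * s + 1) * Dl n + k * Q l := by ring
      rw [h5]
      exact claimA hp hg hn hd hgn ⟨s, rfl⟩ h4 (Dvd.intro_left _ rfl))
  rw [Finset.card_image_of_injective _ (by
    intro i j hij
    have : i * Q l = j * Q l := by simpa using hij
    exact Nat.eq_of_mul_eq_mul_right hQ this), Finset.card_range] at h3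
  set c := cnt (HH hp g d N0 n) N
  have h6 : K * N ≤ K * (96 * Q l * c) := by
    calc K * N ≤ 3 * (2 * Dl n) * c := h3
      _ = 96 * LL n * c := by rw [hDL]; ring
      _ ≤ 96 * (K * Q l) * c := by gcongr
      _ = _ := by ring
  have h7 : N ≤ 96 * Q l * c := Nat.le_of_mul_le_mul_left h6 (Nat.succ_pos _)
  have h8 : (N:ℝ) ≤ 96 * Q l * c := by exact_mod_cast h7
  have h9 : (0:ℝ) < 96 * Q l := by have : (0:ℝ) < Q l := by exact_mod_cast hQ
                                   positivity
  rw [one_div, inv_mul_eq_div, div_le_iff₀ h9]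
  linarith

lemma PP_succ (hg : Good g) {d : X p} {N0 n : ℕ} {δ : ℝ} (h : PP hp g d N0 n δ) :
    PP hp g d N0 (n + 1) (δ / 96) := by
  intro N hN
  have hD := Dl_pos (n + 1)
  have hDL := Dl_eq (n + 1)
  have hL := LL_pos (n + 1)
  have hDD := Dl_succ_ge' n
  have h1 := h (LL (n + 1)) (by omega)
  have h3 := cnt_ge (q := 2 * Dl (n + 1)) (by omega) (R := (Finset.Icc 1 (LL (n + 1))).filter (· ∈ HH hp g d N0 n))
    (P := HH hp g d N0 (n + 1)) (N := N) (by
      intro r hr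
      simp only [Finset.mem_filter, Finset.mem_Icc] at hr
      omega) (by omega) (by
      intro s _ r hr _
      simp only [Finset.mem_filter, Finset.mem_Icc] at hr
      have h5 : s * (2 * Dl (n + 1)) + r = (2 * s) * Dl (n + 1) + r := by ring
      rw [h5]
      exact claimB hp hg (by simp) hr.1.2 hr.2)
  change cnt (HH hp g d N0 n) (LL (n + 1)) * N ≤ _ at h3
  set c := cnt (HH hp g d N0 (n + 1)) N
  set c0 := cnt (HH hp g d N0 n) (LL (n + 1))
  have h4 : (c0 : ℝ) * N ≤ 96 * LL (n + 1) * c := by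
    have : c0 * N ≤ 96 * LL (n + 1) * c := h3.trans (le_of_eq (by rw [hDL]; ring))
    exact_mod_cast this
  have h5 : (0:ℝ) < LL (n + 1) := by exact_mod_cast hL
  have h6 : (LL (n + 1) : ℝ) * (δ * N) ≤ LL (n + 1) * (96 * c) := by
    calc (LL (n + 1) : ℝ) * (δ * N) = (δ * LL (n + 1)) * N := by ring
      _ ≤ c0 * N := by gcongr
      _ ≤ _ := h4
      _ = _ := by ring
  have h7 := le_of_mul_le_mul_left h6 h5
  linarith

lemma PP_add (hg : Good g) {d : X p} {N0 n : ℕ} {δ : ℝ} (h : PP hp g d N0 n δ) (k : ℕ) :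
    PP hp g d N0 (n + k) (δ / 96 ^ k) := by
  induction k with
  | zero => simpa using h
  | succ k ih =>
    have := PP_succ hp hg ih
    rwa [div_div, ← pow_succ] at this

lemma PP_all (hg : Good g) {d : X p} {l N0 G : ℕ} (hd : Supp l d)
    (hG : ∀ n ≥ N0, ∃ m, n ≤ m ∧ m ≤ n + G ∧ g m = d) (n : ℕ) (hn : N0 + G ≤ n) :
    PP hp g d N0 n (1 / (96 * Q l) / 96 ^ G) := by
  obtain ⟨m, h1, h2, h3⟩ := hG (n - G) (by omega)
  obtain ⟨k, rfl⟩ : ∃ k, n = m + k := ⟨n - m, by omega⟩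
  have h4 := PP_add hp hg (PP_start hp hg (N0 := N0) (by omega) hd h3) k
  intro N hN
  refine le_trans ?_ (h4 N hN)
  gcongr
  · norm_num
  · omega

lemma visit_pos (hg : Good g) {d : X p} {l N0 G : ℕ} (hd : Supp l d)
    (hG : ∀ n ≥ N0, ∃ m, n ≤ m ∧ m ≤ n + G ∧ g m = d) {V : Set (X p)}
    (hV : ∀ z, ‖z - d‖ ≤ (1 / 2) ^ N0 → z ∈ V) : 0 < lowerDensity (visitSet (T hp g) (xx p) V) := by
  set δ : ℝ := 1 / (96 * Q l) / 96 ^ G with hδ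
  have hQ : (0:ℝ) < Q l := by exact_mod_cast Q_pos l
  have hδ0 : 0 < δ := by positivity
  apply ld_pos (c := δ / 64) (by positivity) (N0 := 4 * Dl (N0 + G) + 1)
  intro N hN
  have h00 : Dl 0 ≤ Dl (N0 + G) := Dl_mono.monotone (Nat.zero_le _)
  obtain ⟨n, h1, h2⟩ := exists_scale (N := N / 2) (by omega)
  have hn : N0 + G ≤ n := by
    have : N0 + G < n + 1 := Dl_mono.lt_iff_lt.1 (by omega)
    omega
  have hDD := Dl_succ_ge' n
  have hDL := Dl_eq (n + 1)
  set N' := min N (LL (n + 1)) with hN'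
  have h3 := PP_all hp hg hd hG n hn N' (by omega)
  have h4 : cnt (HH hp g d N0 n) N' ≤ cnt (visitSet (T hp g) (xx p) V) N := by
    apply cnt_mono (by omega)
    intro t _ ht hH
    exact hV _ (claimC hp hg (by omega) hH)
  have h5 : N ≤ 64 * N' := by omega
  have h4' : (cnt (HH hp g d N0 n) N' : ℝ) ≤ cnt (visitSet (T hp g) (xx p) V) N := by exact_mod_cast h4
  have h5' : (N : ℝ) ≤ 64 * N' := by exact_mod_cast h5
  calc δ / 64 * N ≤ δ / 64 * (64 * N') := by gcongr
    _ = δ * N' := by ring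
    _ ≤ _ := h3
    _ ≤ _ := h4'

lemma fin_dense (hp : p ≠ ∞) : Dense {y : X p | ∃ n, Supp n y} := by
  intro x
  have h1 := lp.hasSum_single hp x
  refine mem_closure_of_tendsto h1 (Filter.Eventually.of_forall fun s => ?_)
  refine ⟨s.sup id + 1, Supp.sum _ _ fun i hi k hk => ?_⟩
  have h2 : i ≤ s.sup id := Finset.le_sup (f := id) hi
  have h3 := le_b (s.sup id + 1)
  exact lp.single_apply_ne (E := fun _ : ℕ => ℂ) p i _ (by omega)

lemma exists_d (hp : p ≠ ∞) : ∃ d : ℕ → X p, DenseRange d ∧ ∀ l, ∃ n, Supp n (d l) := by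
  let W : Submodule ℂ (X p) := Submodule.span ℂ (Set.range (e p))
  have hW : TopologicalSpace.IsSeparable (W : Set (X p)) :=
    TopologicalSpace.IsSeparable.span (Set.countable_range (e p)).isSeparable
  have hF : {y : X p | ∃ n, Supp n y} ⊆ W := by
    rintro y ⟨n, hy⟩
    rw [hy.eq_sum]
    exact Submodule.sum_mem _ fun k _ => Submodule.smul_mem _ _ (Submodule.subset_span ⟨k, rfl⟩)
  obtain ⟨c, hc1, hc2, hc3⟩ := (hW.mono hF).exists_countable_dense_subset
  have hcd : Dense c := by
    intro x
    have := (fin_dense hp).closure_eq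
    have h2 : closure {y : X p | ∃ n, Supp n y} ⊆ closure c := closure_minimal hc3 isClosed_closure
    exact h2 (this ▸ Set.mem_univ x)
  obtain ⟨d, hd⟩ := hc2.exists_eq_range hcd.nonempty
  refine ⟨d, ?_, fun l => ?_⟩
  · rw [DenseRange, ← hd]; exact hcd
  · exact hc1 (hd ▸ ⟨l, rfl⟩)

lemma val_gap (l n : ℕ) : ∃ m, n ≤ m ∧ m ≤ n + 2 ^ (l + 2) ∧ padicValNat 2 (m + 1) = l := by
  have h2 : 0 < 2 ^ l := by positivity
  set q := n / 2 ^ l with hq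
  have h3 : q * 2 ^ l ≤ n := Nat.div_mul_le_self n (2 ^ l)
  have h4 := Nat.lt_div_mul_add (a := n) h2
  rw [← hq] at h4
  have h5 : 2 ^ (l + 2) = 4 * 2 ^ l := by ring
  obtain ⟨w, hw1, hw2, hw3⟩ : ∃ w, Odd w ∧ q + 2 ≤ w ∧ w ≤ q + 3 := by
    rcases Nat.even_or_odd q with h | h
    · exact ⟨q + 3, h.add_odd (by decide), by omega, le_rfl⟩
    · exact ⟨q + 2, h.add_even (by decide), le_rfl, by omega⟩
  have h6 : (q + 2) * 2 ^ l ≤ w * 2 ^ l := Nat.mul_le_mul_right _ hw2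
  have h7 : w * 2 ^ l ≤ (q + 3) * 2 ^ l := Nat.mul_le_mul_right _ hw3
  have h8 : (q + 2) * 2 ^ l = q * 2 ^ l + 2 * 2 ^ l := by ring
  have h9 : (q + 3) * 2 ^ l = q * 2 ^ l + 3 * 2 ^ l := by ring
  refine ⟨w * 2 ^ l - 1, by omega, by omega, ?_⟩
  rw [Nat.sub_add_cancel (by omega)]
  have hw0 : w ≠ 0 := hw1.pos.ne'
  have : Fact (Nat.Prime 2) := ⟨Nat.prime_two⟩
  rw [padicValNat.mul hw0 (by positivity), padicValNat.prime_pow, padicValNat.eq_zero_of_not_dvd, zero_add]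
  rw [← even_iff_two_dvd]
  exact Nat.not_even_iff_odd.2 hw1

noncomputable def gg (d : ℕ → X p) (n : ℕ) : X p :=
  if Supp n (d (padicValNat 2 (n + 1))) ∧ ‖d (padicValNat 2 (n + 1))‖ ≤ n + 1 then d (padicValNat 2 (n + 1)) else 0

lemma gg_good (d : ℕ → X p) : Good (gg d) := by
  constructor
  · intro n
    unfold gg
    split_ifs with h
    · exact h.1
    · intro k _; rfl
  · intro n
    unfold gg
    split_ifs with h
    · exact h.2
    · rw [norm_zero]; positivity

lemma FHC_all {d : ℕ → X p} (hd1 : DenseRange d) (hd2 : ∀ l, ∃ n, Supp n (d l)) (V : Set (X p)) (hV : IsOpen V)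
    (hne : V.Nonempty) : 0 < lowerDensity (visitSet (T hp (gg d)) (xx p) V) := by
  obtain ⟨l, hl⟩ := hd1.exists_mem_open hV hne
  obtain ⟨k, hk⟩ := hd2 l
  obtain ⟨ε, hε, hball⟩ := Metric.isOpen_iff.1 hV _ hl
  obtain ⟨a, ha⟩ := exists_pow_lt_of_lt_one hε (show (1:ℝ) / 2 < 1 by norm_num)
  obtain ⟨c, hc⟩ := exists_nat_gt ‖d l‖
  apply visit_pos hp (gg_good d) (d := d l) (l := k) (N0 := a + c + k) (G := 2 ^ (l + 2)) hk
  · intro n hn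
    obtain ⟨m, h1, h2, h3⟩ := val_gap l n
    refine ⟨m, h1, h2, ?_⟩
    unfold gg
    rw [h3, if_pos]
    refine ⟨hk.mono (by omega), ?_⟩
    have : (c:ℝ) ≤ m := by exact_mod_cast (by omega : c ≤ m)
    linarith
  · intro z hz
    apply hball
    rw [mem_ball_iff_norm]
    have : ((1:ℝ) / 2) ^ (a + c + k) ≤ (1 / 2) ^ a := pow_le_pow_of_le_one (by norm_num) (by norm_num) (by omega)
    linarith

lemma ld_nonempty {A : Set ℕ} (h : 0 < lowerDensity A) : A.Nonempty := by
  by_contra hA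
  rw [Set.not_nonempty_iff_eq_empty] at hA
  obtain ⟨c, hc, N0, hN0⟩ := ld_exists h
  have h2 := hN0 (N0 + 1) (by omega)
  rw [cnt_eq_zero (by intro t; rw [hA]; exact Set.notMem_empty t)] at h2
  push_cast at h2
  have : 0 < c * ((N0:ℝ) + 1) := by positivity
  linarith

theorem main (hp : p ≠ ∞) : ∃ (T : X p →L[ℂ] X p) (A : Set ℕ),
      0 < lowerDensity A ∧ FrequentlyHypercyclic T ∧ Chaotic T ∧
      ¬ FrequentlyHypercyclicAlong T A := by
  obtain ⟨d, hd1, hd2⟩ := exists_d hp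
  refine ⟨T hp (gg d), AA, AA_pos, ⟨xx p, FHC_all hp hd1 hd2⟩, ⟨⟨xx p, ?_⟩, ?_⟩, not_FHC hp (gg_good d)⟩
  · rw [dense_iff_inter_open]
    intro V hV hne
    obtain ⟨t, ht⟩ := ld_nonempty (FHC_all hp hd1 hd2 V hV hne)
    exact ⟨_, ht, t, rfl⟩
  · refine (fin_dense hp).mono ?_
    rintro y ⟨n, hy⟩
    exact ⟨Q n, Q_pos n, T_pow_Q hp (gg_good d) n y hy⟩

end FH

/-- For `1 ≤ p < ∞`, there exist an operator `T` on `ℓ_p(ℤ₊)` and a set `A ⊆ ℕ` of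
positive lower density such that `T` is frequently hypercyclic and chaotic, but not
frequently hypercyclic along `A` (hence not hereditarily frequently hypercyclic). -/
theorem exists_FHC_chaotic_not_FHC_along
    (p : ℝ≥0∞) [Fact (1 ≤ p)] (hp : p ≠ ∞) :
    ∃ (T : lp (fun _ : ℕ => ℂ) p →L[ℂ] lp (fun _ : ℕ => ℂ) p) (A : Set ℕ),
      0 < lowerDensity A ∧ FrequentlyHypercyclic T ∧ Chaotic T ∧
      ¬ FrequentlyHypercyclicAlong T A := by
  exact FH.main hp
end
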